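/- arXiv:1801.07589 — 3 statements merged into one kernel-verified Lean document; each statement's English description precedes it below -/
import Mathlib

section
/- Let $\mathbf{b} \colon B_R \times [0,T] \to \mathbb{R}^2$ be a smooth solution of $\mathbf{b}_t - \mathbf{b}\cdot\nabla\mathbf{u} + \mathbf{u}\cdot\nabla\mathbf{b} + \mathbf{b}\,\mathrm{div}\,\mathbf{u} = 0$ with $\mathbf{b} = 0$ on $\partial B_R$ and $\mathbf{u}$ smooth vanishing on $\partial B_R$. Then $\frac{d}{dt}\|\mathbf{b}(t)\|_{L^4(B_R)}^4 \le C \int_{B_R} |\nabla\mathbf{u}| |\mathbf{b}|^4 \, dx \le C \|\nabla\mathbf{u}\|_{L^2} \|\mathbf{b}\|_{L^2} \|\nabla\mathbf{b}\|_{L^2}^3$ for a universal constant $C$, where the last step uses the 2D Gagliardo–Nirenberg inequality $\|\mathbf{b}\|_{L^8}^4 \le C\|\mathbf{b}\|_{L^2}\|\nabla\mathbf{b}\|_{L^2}^3$. -/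
open MeasureTheory Metric Real

noncomputable section

abbrev E8 := EuclideanSpace ℝ (Fin 2)

def pd8 (f : E8 → ℝ) (i : Fin 2) (x : E8) : ℝ :=
  fderiv ℝ f x (EuclideanSpace.single i 1)

theorem integrableOn_ball_of_continuous {f : E8 → ℝ} (hf : Continuous f) (R : ℝ) :
    IntegrableOn f (ball (0 : E8) R) :=
  (hf.continuousOn.integrableOn_compact (isCompact_closedBall (0 : E8) R)).mono_set
    ball_subset_closedBall

theorem sq_setIntegral_mul_le {f g : E8 → ℝ} (hf : Continuous f) (hg : Continuous g) (R : ℝ) :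
    (∫ x in ball (0 : E8) R, f x * g x) ^ 2
      ≤ (∫ x in ball (0 : E8) R, f x ^ 2) * ∫ x in ball (0 : E8) R, g x ^ 2 := by
  have key : ∀ c : ℝ, 0 ≤ (∫ x in ball (0 : E8) R, g x ^ 2) * (c * c)
      + (-2 * ∫ x in ball (0 : E8) R, f x * g x) * c + ∫ x in ball (0 : E8) R, f x ^ 2 := by
    intro c
    have h0 : 0 ≤ ∫ x in ball (0 : E8) R, (f x - c * g x) ^ 2 :=
      integral_nonneg fun x => sq_nonneg _
    have h1 : ∫ x in ball (0 : E8) R, (f x - c * g x) ^ 2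
        = ∫ x in ball (0 : E8) R, (((c * c) * g x ^ 2 + (-2 * c) * (f x * g x)) + f x ^ 2) := by
      congr 1 with x
      ring
    have i1 := integrableOn_ball_of_continuous (f := fun x => (c * c) * g x ^ 2) (by fun_prop) R
    have i2 := integrableOn_ball_of_continuous (f := fun x => (-2 * c) * (f x * g x))
      (by fun_prop) R
    have i3 := integrableOn_ball_of_continuous (f := fun x => f x ^ 2) (by fun_prop) R
    have h2 := integral_add (i1.add i2) i3
    have h3 := integral_add i1 i2
    simp only [Pi.add_apply, integral_const_mul] at h2 h3
    linarith
  have := discrim_le_zero key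
  rw [discrim] at this
  nlinarith

theorem hasDerivAt_setIntegral_ball {F : ℝ × E8 → ℝ} (hF : ContDiff ℝ 1 F) (R t : ℝ) :
    HasDerivAt (fun s => ∫ x in ball (0 : E8) R, F (s, x))
      (∫ x in ball (0 : E8) R, deriv (fun s => F (s, x)) t) t := by
  have hd : ∀ s x, HasDerivAt (fun s => F (s, x)) (fderiv ℝ F (s, x) (1, 0)) s := fun s x =>
    ((hF.differentiable one_ne_zero (s, x)).hasFDerivAt).comp_hasDerivAt s
      ((hasDerivAt_id s).prodMk (hasDerivAt_const s x))
  have hc : Continuous fun p : ℝ × E8 => fderiv ℝ F p (1, 0) :=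
    (hF.continuous_fderiv one_ne_zero).clm_apply continuous_const
  obtain ⟨M, hM⟩ := ((isCompact_closedBall t 1).prod
    (isCompact_closedBall (0 : E8) R)).exists_bound_of_continuousOn hc.continuousOn
  simp_rw [fun x => (hd t x).deriv]
  have hFc := hF.continuous
  refine (hasDerivAt_integral_of_dominated_loc_of_deriv_le (bound := fun _ => M)
    (F' := fun s x => fderiv ℝ F (s, x) (1, 0)) (closedBall_mem_nhds t one_pos) ?_ ?_ ?_ ?_ ?_ ?_).2
  · exact .of_forall fun s =>
      (hFc.comp (Continuous.prodMk_right s)).aestronglyMeasurable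
  · exact integrableOn_ball_of_continuous (hFc.comp (Continuous.prodMk_right t)) R
  · exact (hc.comp (Continuous.prodMk_right t)).aestronglyMeasurable
  · filter_upwards [ae_restrict_mem measurableSet_ball] with x hx s hs
    exact hM (s, x) ⟨hs, ball_subset_closedBall hx⟩
  · exact integrableOn_ball_of_continuous continuous_const R
  · exact .of_forall fun x s _ => hd s x

theorem hasFDerivAt_indicator_ball {f : E8 → ℝ} {R : ℝ} (hf : Differentiable ℝ f)
    (h0 : ∀ x ∈ sphere (0 : E8) R, f x = 0) (h1 : ∀ x ∈ sphere (0 : E8) R, fderiv ℝ f x = 0)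
    (x : E8) : HasFDerivAt ((ball (0 : E8) R).indicator f)
      ((ball (0 : E8) R).indicator (fderiv ℝ f) x) x := by
  rcases lt_trichotomy (dist x 0) R with h | h | h
  · rw [Set.indicator_of_mem (by exact h)]
    refine (hf x).hasFDerivAt.congr_of_eventuallyEq ?_
    filter_upwards [isOpen_ball.mem_nhds (show x ∈ ball (0 : E8) R from h)] with y hy
    exact Set.indicator_of_mem hy f
  · have hx : x ∉ ball (0 : E8) R := by simp [mem_ball, h]
    rw [Set.indicator_of_notMem hx]
    have hfx := (hf x).hasFDerivAt
    rw [h1 x h] at hfx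
    rw [hasFDerivAt_iff_isLittleO] at hfx ⊢
    refine (Asymptotics.isBigO_of_le _ fun y => ?_).trans_isLittleO hfx
    by_cases hy : y ∈ ball (0 : E8) R <;> simp [hy, hx, h0 x h]
  · rw [Set.indicator_of_notMem (by simpa [mem_ball] using h.le)]
    refine (hasFDerivAt_const (0 : ℝ) x).congr_of_eventuallyEq ?_
    filter_upwards [isClosed_closedBall.isOpen_compl.mem_nhds
      (show x ∈ (closedBall (0 : E8) R)ᶜ by simpa using h)] with y hy
    exact Set.indicator_of_notMem (fun hy' => hy (ball_subset_closedBall hy')) f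

theorem contDiff_indicator_ball {f : E8 → ℝ} {R : ℝ} (hR : 0 < R) (hf : ContDiff ℝ 1 f)
    (h0 : ∀ x ∈ sphere (0 : E8) R, f x = 0) (h1 : ∀ x ∈ sphere (0 : E8) R, fderiv ℝ f x = 0) :
    ContDiff ℝ 1 ((ball (0 : E8) R).indicator f) := by
  refine contDiff_one_iff_hasFDerivAt.2 ⟨_, ?_,
    hasFDerivAt_indicator_ball (hf.differentiable one_ne_zero) h0 h1⟩
  refine Continuous.indicator ?_ (hf.continuous_fderiv one_ne_zero)
  intro x hx
  rw [frontier_ball _ hR.ne'] at hx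
  exact h1 x hx

theorem hasCompactSupport_indicator_ball (f : E8 → ℝ) (R : ℝ) :
    HasCompactSupport ((ball (0 : E8) R).indicator f) :=
  HasCompactSupport.intro (isCompact_closedBall (0 : E8) R) fun _ hx =>
    Set.indicator_of_notMem (fun h => hx (ball_subset_closedBall h)) f

theorem setIntegral_ball_mul_pd8 {f v : E8 → ℝ} {R : ℝ} (hR : 0 < R) (hf : ContDiff ℝ 1 f)
    (hv : ContDiff ℝ 1 v)
    (h0 : ∀ x ∈ sphere (0 : E8) R, f x = 0) (h1 : ∀ x ∈ sphere (0 : E8) R, fderiv ℝ f x = 0)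
    (i : Fin 2) :
    ∫ x in ball (0 : E8) R, v x * pd8 f i x = - ∫ x in ball (0 : E8) R, f x * pd8 v i x := by
  have hg := contDiff_indicator_ball hR hf h0 h1
  have hs := hasCompactSupport_indicator_ball f R
  set g := (ball (0 : E8) R).indicator f with hgdef
  have hg' : ∀ x, fderiv ℝ g x = (ball (0 : E8) R).indicator (fderiv ℝ f) x := fun x =>
    (hasFDerivAt_indicator_ball (hf.differentiable one_ne_zero) h0 h1 x).fderiv
  have hgc := hg.continuous
  have hvc := hv.continuous
  have hgc' : Continuous fun x => fderiv ℝ g x (EuclideanSpace.single i 1) :=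
    (hg.continuous_fderiv one_ne_zero).clm_apply continuous_const
  have hvc' : Continuous fun x => fderiv ℝ v x (EuclideanSpace.single i 1) :=
    (hv.continuous_fderiv one_ne_zero).clm_apply continuous_const
  have hs' : HasCompactSupport fun x => fderiv ℝ g x (EuclideanSpace.single i 1) :=
    hs.fderiv_apply ℝ _
  have key := integral_mul_fderiv_eq_neg_fderiv_mul_of_integrable (μ := (volume : Measure E8))
    (f := v) (g := g) (v := EuclideanSpace.single i 1)
    ((hvc'.mul hgc).integrable_of_hasCompactSupport hs.mul_left)
    ((hvc.mul hgc').integrable_of_hasCompactSupport hs'.mul_left)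
    ((hvc.mul hgc).integrable_of_hasCompactSupport hs.mul_left)
    (fun x _ => hv.differentiable one_ne_zero x) (fun x _ => hg.differentiable one_ne_zero x)
  rw [← integral_indicator measurableSet_ball, ← integral_indicator measurableSet_ball]
  have e1 : ∀ x, (ball (0 : E8) R).indicator (fun x => v x * pd8 f i x) x
      = v x * fderiv ℝ g x (EuclideanSpace.single i 1) := fun x => by
    by_cases hx : x ∈ ball (0 : E8) R <;> simp [hg', hx, pd8]
  have e2 : ∀ x, (ball (0 : E8) R).indicator (fun x => f x * pd8 v i x) x
      = fderiv ℝ v x (EuclideanSpace.single i 1) * g x := fun x => by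
    by_cases hx : x ∈ ball (0 : E8) R <;> simp [hgdef, hx, pd8, mul_comm]
  simp_rw [e1, e2]
  exact key

theorem exists_setIntegral_sq_le : ∃ K : ℝ, 0 < K ∧ ∀ (R : ℝ) (f : E8 → ℝ), 0 < R →
    ContDiff ℝ 1 f → (∀ x ∈ sphere (0 : E8) R, f x = 0) →
    (∀ x ∈ sphere (0 : E8) R, fderiv ℝ f x = 0) →
    ∫ x in ball (0 : E8) R, f x ^ 2 ≤ K * (∫ x in ball (0 : E8) R, ‖fderiv ℝ f x‖) ^ 2 := by
  refine ⟨lintegralPowLePowLIntegralFDerivConst (volume : Measure E8) 2 + 1, by positivity, ?_⟩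
  intro R f hR hf h0 h1
  have hg := contDiff_indicator_ball hR hf h0 h1
  have hs := hasCompactSupport_indicator_ball f R
  set g := (ball (0 : E8) R).indicator f with hgdef
  have hg' : ∀ x, fderiv ℝ g x = (ball (0 : E8) R).indicator (fderiv ℝ f) x := fun x =>
    (hasFDerivAt_indicator_ball (hf.differentiable one_ne_zero) h0 h1 x).fderiv
  have key := lintegral_pow_le_pow_lintegral_fderiv (volume : Measure E8) hg hs (p := 2)
    (by simpa using Real.HolderConjugate.two_two)
  set c := lintegralPowLePowLIntegralFDerivConst (volume : Measure E8) 2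
  have e1 : ∫⁻ x, ‖fderiv ℝ g x‖ₑ = ENNReal.ofReal (∫ x, ‖fderiv ℝ g x‖) :=
    (ofReal_integral_norm_eq_lintegral_enorm
      ((hg.continuous_fderiv one_ne_zero).integrable_of_hasCompactSupport (hs.fderiv ℝ))).symm
  have e2 : ∫⁻ x, ‖g x‖ₑ ^ (2 : ℝ) = ENNReal.ofReal (∫ x, g x ^ 2) := by
    rw [ofReal_integral_eq_lintegral_ofReal]
    · congr 1 with x
      rw [← enorm_norm, Real.enorm_eq_ofReal (norm_nonneg _),
        ENNReal.ofReal_rpow_of_nonneg (norm_nonneg _) zero_le_two]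
      simp
    · refine (hg.continuous.pow 2).integrable_of_hasCompactSupport
        (HasCompactSupport.intro hs.isCompact fun x hx => ?_)
      simp [image_eq_zero_of_notMem_tsupport hx]
    · exact .of_forall fun x => sq_nonneg _
  have n1 : 0 ≤ ∫ x, ‖fderiv ℝ g x‖ := integral_nonneg fun x => norm_nonneg _
  rw [e1, e2, ENNReal.ofReal_rpow_of_nonneg n1 zero_le_two, ← ENNReal.ofReal_coe_nnreal,
    ← ENNReal.ofReal_mul c.coe_nonneg, ENNReal.ofReal_le_ofReal_iff (by positivity)] at key
  have e3 : ∫ x in ball (0 : E8) R, f x ^ 2 = ∫ x, g x ^ 2 := by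
    rw [← integral_indicator measurableSet_ball]
    congr 1 with x
    by_cases hx : x ∈ ball (0 : E8) R <;> simp [hgdef, hx]
  have e4 : ∫ x in ball (0 : E8) R, ‖fderiv ℝ f x‖ = ∫ x, ‖fderiv ℝ g x‖ := by
    rw [← integral_indicator measurableSet_ball]
    congr 1 with x
    by_cases hx : x ∈ ball (0 : E8) R <;> simp [hg', hx]
  rw [e3, e4]
  rw [Real.rpow_two] at key
  nlinarith [sq_nonneg (∫ x, ‖fderiv ℝ g x‖)]

theorem abs_sum_mul_le (b : Fin 2 → ℝ) (p : Fin 2 → Fin 2 → ℝ) (h : Fin 2 → ℝ) :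
    |∑ j, b j * ∑ i, h i * p i j|
      ≤ √(∑ i, b i ^ 2) * √(∑ i, ∑ j, p i j ^ 2) * √(∑ i, h i ^ 2) := by
  rw [← Real.sqrt_mul (by positivity), ← Real.sqrt_mul (by positivity)]
  apply Real.abs_le_sqrt
  calc (∑ j, b j * ∑ i, h i * p i j) ^ 2
      ≤ (∑ j, b j ^ 2) * ∑ j, (∑ i, h i * p i j) ^ 2 := Finset.sum_mul_sq_le_sq_mul_sq _ _ _
    _ ≤ (∑ j, b j ^ 2) * ∑ j, (∑ i, h i ^ 2) * ∑ i, p i j ^ 2 := by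
        gcongr
        exact Finset.sum_mul_sq_le_sq_mul_sq _ _ _
    _ = _ := by
        rw [← Finset.mul_sum, Finset.sum_comm]
        ring

theorem abs_trace_le (p : Fin 2 → Fin 2 → ℝ) :
    |∑ i, p i i| ≤ 2 * √(∑ i, ∑ j, p i j ^ 2) := by
  have h : ∀ i : Fin 2, |p i i| ≤ √(∑ i, ∑ j, p i j ^ 2) := fun i => by
    apply Real.abs_le_sqrt
    simp only [Fin.sum_univ_two]
    fin_cases i <;> simp <;> nlinarith [sq_nonneg (p 0 0), sq_nonneg (p 0 1), sq_nonneg (p 1 0),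
      sq_nonneg (p 1 1)]
  rw [Fin.sum_univ_two]
  linarith [abs_add_le (p 0 0) (p 1 1), h 0, h 1]

theorem hasFDerivAt_sum_sq_sq {E : Type*} [NormedAddCommGroup E] [NormedSpace ℝ E]
    {b : Fin 2 → E → ℝ} {b' : Fin 2 → E →L[ℝ] ℝ} {x : E} (h : ∀ i, HasFDerivAt (b i) (b' i) x) :
    HasFDerivAt (fun y => (∑ i, b i y ^ 2) ^ 2)
      ((4 * ∑ i, b i x ^ 2) • ∑ j, b j x • b' j) x := by
  have h1 := (HasFDerivAt.fun_sum (u := Finset.univ) fun i _ => (h i).pow 2).pow 2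
  convert! h1 using 1
  ext v
  simp [Fin.sum_univ_two]
  ring

theorem fderiv_sum_sq_sq_apply {b : Fin 2 → E8 → ℝ} (hb : ∀ i, ContDiff ℝ 1 (b i)) (x v : E8) :
    fderiv ℝ (fun y => (∑ i, b i y ^ 2) ^ 2) x v
      = 4 * (∑ i, b i x ^ 2) * ∑ j, b j x * fderiv ℝ (b j) x v := by
  rw [(hasFDerivAt_sum_sq_sq fun i =>
    ((hb i).differentiable one_ne_zero x).hasFDerivAt).fderiv]
  simp [Fin.sum_univ_two]
  ring

theorem fderiv_apply_eq_sum_pd8 (f : E8 → ℝ) (x v : E8) :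
    fderiv ℝ f x v = ∑ i, v i * pd8 f i x := by
  have hv : v = ∑ i, v i • EuclideanSpace.single i (1 : ℝ) := by
    ext j
    fin_cases j <;> simp [Fin.sum_univ_two]
  conv_lhs => rw [hv]
  simp [pd8]

theorem norm_fderiv_sum_sq_sq_le {b : Fin 2 → E8 → ℝ} (hb : ∀ i, ContDiff ℝ 1 (b i)) (x : E8) :
    ‖fderiv ℝ (fun y => (∑ i, b i y ^ 2) ^ 2) x‖
      ≤ 4 * (((∑ i, b i x ^ 2) * √(∑ i, b i x ^ 2)) * √(∑ i, ∑ j, pd8 (b j) i x ^ 2)) := by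
  refine ContinuousLinearMap.opNorm_le_bound _ (by positivity) fun v => ?_
  rw [fderiv_sum_sq_sq_apply hb, Real.norm_eq_abs, abs_mul, abs_of_nonneg (by positivity)]
  simp_rw [fderiv_apply_eq_sum_pd8 _ x v]
  have h := abs_sum_mul_le (fun j => b j x) (fun i j => pd8 (b j) i x) (fun i => v i)
  have hv : ‖v‖ = √(∑ i, v i ^ 2) := by simp [EuclideanSpace.norm_eq]
  rw [hv]
  calc _ ≤ 4 * (∑ i, b i x ^ 2) * (√(∑ i, b i x ^ 2) * √(∑ i, ∑ j, pd8 (b j) i x ^ 2)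
        * √(∑ i, v i ^ 2)) := by gcongr
    _ = _ := by ring

theorem continuous_pd8 {f : E8 → ℝ} (hf : ContDiff ℝ 1 f) (i : Fin 2) :
    Continuous (pd8 f i) :=
  (hf.continuous_fderiv one_ne_zero).clm_apply continuous_const

/-- A Gagliardo–Nirenberg inequality on a ball: `‖b‖₈⁸ ≤ C ‖b‖₂² ‖∇b‖₂⁶`. -/
theorem exists_setIntegral_pow_four_le : ∃ K : ℝ, 0 < K ∧ ∀ (R : ℝ) (b : Fin 2 → E8 → ℝ), 0 < R →
    (∀ i, ContDiff ℝ 1 (b i)) → (∀ x ∈ sphere (0 : E8) R, ∀ i, b i x = 0) →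
    ∫ x in ball (0 : E8) R, ((∑ i, b i x ^ 2) ^ 2) ^ 2
      ≤ K ^ 3 * (∫ x in ball (0 : E8) R, ∑ i, b i x ^ 2)
        * (∫ x in ball (0 : E8) R, ∑ i, ∑ j, pd8 (b j) i x ^ 2) ^ 3 := by
  obtain ⟨K, hK, h⟩ := exists_setIntegral_sq_le
  refine ⟨16 * K, by positivity, fun R b hR hb h0 => ?_⟩
  have hbc : ∀ i, Continuous (b i) := fun i => (hb i).continuous
  have hpc : ∀ i j, Continuous (pd8 (b j) i) := fun i j => continuous_pd8 (hb j) i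
  have hX := h R (fun y => (∑ i, b i y ^ 2) ^ 2) hR (by fun_prop)
    (fun x hx => by simp [h0 x hx])
    (fun x hx => by ext v; rw [fderiv_sum_sq_sq_apply hb]; simp [h0 x hx])
  set S : E8 → ℝ := fun x => ∑ i, b i x ^ 2 with hS
  set G : E8 → ℝ := fun x => ∑ i, ∑ j, pd8 (b j) i x ^ 2 with hG
  have hSc : Continuous S := by fun_prop
  have hGc : Continuous G := by fun_prop
  have hS0 : ∀ x, 0 ≤ S x := fun x => by positivity
  have hG0 : ∀ x, 0 ≤ G x := fun x => by positivity
  have h1 : ∫ x in ball (0 : E8) R, ‖fderiv ℝ (fun y => S y ^ 2) x‖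
      ≤ 4 * ∫ x in ball (0 : E8) R, (S x * √(S x)) * √(G x) := by
    rw [← integral_const_mul]
    refine integral_mono_of_nonneg (.of_forall fun x => norm_nonneg _)
      (integrableOn_ball_of_continuous (by fun_prop) R)
      (.of_forall fun x => norm_fderiv_sum_sq_sq_le hb x)
  have h2 := sq_setIntegral_mul_le (f := fun x => S x * √(S x)) (g := fun x => √(G x))
    (by fun_prop) (by fun_prop) R
  have h3 := sq_setIntegral_mul_le (f := fun x => S x ^ 2) (g := S) (by fun_prop) hSc R
  have h4 := sq_setIntegral_mul_le (f := fun x => S x * √(S x)) (g := fun x => √(S x))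
    (by fun_prop) (by fun_prop) R
  have e1 : ∀ x, (S x * √(S x)) * √(S x) = S x ^ 2 := fun x => by
    rw [mul_assoc, Real.mul_self_sqrt (hS0 x), sq]
  have e2 : ∀ x, (S x * √(S x)) ^ 2 = S x ^ 2 * S x := fun x => by
    rw [mul_pow, Real.sq_sqrt (hS0 x)]
  simp only [e1, e2, Real.sq_sqrt (hS0 _), Real.sq_sqrt (hG0 _)] at h2 h3 h4
  have n0 : 0 ≤ ∫ x in ball (0 : E8) R, ‖fderiv ℝ (fun y => S y ^ 2) x‖ :=
    integral_nonneg fun x => norm_nonneg _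
  have nX : 0 ≤ ∫ x in ball (0 : E8) R, (S x ^ 2) ^ 2 := integral_nonneg fun x => by positivity
  have nM : 0 ≤ ∫ x in ball (0 : E8) R, S x ^ 2 * S x :=
    integral_nonneg fun x => mul_nonneg (sq_nonneg _) (hS0 x)
  have nN : 0 ≤ ∫ x in ball (0 : E8) R, S x ^ 2 := integral_nonneg fun x => by positivity
  have nA : 0 ≤ ∫ x in ball (0 : E8) R, S x := integral_nonneg hS0
  have nG : 0 ≤ ∫ x in ball (0 : E8) R, G x := integral_nonneg hG0
  generalize (∫ x in ball (0 : E8) R, ‖fderiv ℝ (fun y => S y ^ 2) x‖) = J at *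
  generalize (∫ x in ball (0 : E8) R, (S x ^ 2) ^ 2) = X at *
  generalize (∫ x in ball (0 : E8) R, S x ^ 2 * S x) = M at *
  generalize (∫ x in ball (0 : E8) R, S x ^ 2) = N at *
  generalize (∫ x in ball (0 : E8) R, S x) = A at *
  generalize (∫ x in ball (0 : E8) R, G x) = g at *
  generalize (∫ x in ball (0 : E8) R, S x * √(S x) * √(G x)) = L at *
  have hXM : X ≤ 16 * K * (M * g) := by
    have : J ^ 2 ≤ (4 * L) ^ 2 := by gcongr
    nlinarith
  have hM4 : M * M ^ 3 ≤ M * (X ^ 2 * A) := by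
    have : (M ^ 2) ^ 2 ≤ (X * N) ^ 2 := by gcongr
    nlinarith [mul_le_mul_of_nonneg_left h4 (sq_nonneg X)]
  have hM3 : M ^ 3 ≤ X ^ 2 * A := by
    rcases nM.eq_or_lt with hM | hM
    · rw [← hM, zero_pow three_ne_zero]; positivity
    · exact le_of_mul_le_mul_left hM4 hM
  rcases nX.eq_or_lt with hX0 | hX0
  · rw [← hX0]; positivity
  · refine le_of_mul_le_mul_left ?_ (pow_pos hX0 2)
    calc X ^ 2 * X = X ^ 3 := by ring
      _ ≤ (16 * K * (M * g)) ^ 3 := by gcongr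
      _ = (16 * K) ^ 3 * g ^ 3 * M ^ 3 := by ring
      _ ≤ (16 * K) ^ 3 * g ^ 3 * (X ^ 2 * A) := by gcongr
      _ = _ := by ring

theorem pd8_sum_sq_sq {b : Fin 2 → E8 → ℝ} (hb : ∀ i, ContDiff ℝ 1 (b i)) (i : Fin 2) (x : E8) :
    pd8 (fun y => (∑ i, b i y ^ 2) ^ 2) i x
      = 4 * (∑ i, b i x ^ 2) * ∑ j, b j x * pd8 (b j) i x :=
  fderiv_sum_sq_sq_apply hb x _

theorem setIntegral_stretching_transport_le {R : ℝ} (hR : 0 < R) {u b : Fin 2 → E8 → ℝ}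
    (hu : ∀ i, ContDiff ℝ 1 (u i)) (hb : ∀ i, ContDiff ℝ 1 (b i))
    (h0 : ∀ x ∈ sphere (0 : E8) R, ∀ i, b i x = 0) :
    ∫ x in ball (0 : E8) R, 4 * (∑ i, b i x ^ 2) * ∑ j, b j x *
        ((∑ i, b i x * pd8 (u j) i x) - (∑ i, u i x * pd8 (b j) i x)
          - b j x * ∑ i, pd8 (u i) i x)
      ≤ 10 * ∫ x in ball (0 : E8) R,
          √(∑ i, ∑ j, pd8 (u j) i x ^ 2) * (∑ i, b i x ^ 2) ^ 2 := by
  set f : E8 → ℝ := fun y => (∑ i, b i y ^ 2) ^ 2 with hf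
  have hbc : ∀ i, Continuous (b i) := fun i => (hb i).continuous
  have huc : ∀ i, Continuous (u i) := fun i => (hu i).continuous
  have hpu : ∀ i j, Continuous (pd8 (u j) i) := fun i j => continuous_pd8 (hu j) i
  have hpb : ∀ i j, Continuous (pd8 (b j) i) := fun i j => continuous_pd8 (hb j) i
  have hf1 : ContDiff ℝ 1 f := by fun_prop
  have hfc : Continuous f := hf1.continuous
  have hpf : ∀ i, Continuous (pd8 f i) := fun i => continuous_pd8 hf1 i
  have hparts : ∀ i, ∫ x in ball (0 : E8) R, u i x * pd8 f i x
      = - ∫ x in ball (0 : E8) R, f x * pd8 (u i) i x := fun i =>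
    setIntegral_ball_mul_pd8 hR hf1 (hu i) (fun x hx => by simp [hf, h0 x hx])
      (fun x hx => by ext v; rw [hf, fderiv_sum_sq_sq_apply hb]; simp [h0 x hx]) i
  have hzero : ∫ x in ball (0 : E8) R, ∑ i, (u i x * pd8 f i x + f x * pd8 (u i) i x) = 0 := by
    rw [integral_finsetSum _ fun i _ => integrableOn_ball_of_continuous (by fun_prop) R]
    refine Finset.sum_eq_zero fun i _ => ?_
    rw [integral_add (integrableOn_ball_of_continuous (by fun_prop) R)
      (integrableOn_ball_of_continuous (by fun_prop) R), hparts]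
    ring
  rw [← integral_const_mul, ← add_zero (∫ x in ball (0 : E8) R, 4 * _ * _), ← hzero,
    ← integral_add (integrableOn_ball_of_continuous (by fun_prop) R)
      (integrableOn_ball_of_continuous (by fun_prop) R)]
  refine integral_mono (integrableOn_ball_of_continuous (by fun_prop) R)
    (integrableOn_ball_of_continuous (by fun_prop) R) fun x => ?_
  have hS : 0 ≤ ∑ i, b i x ^ 2 := by positivity
  have h1 := abs_sum_mul_le (fun j => b j x) (fun i j => pd8 (u j) i x) (fun i => b i x)
  have h2 := abs_trace_le (fun i j => pd8 (u j) i x)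
  rw [mul_right_comm, Real.mul_self_sqrt hS] at h1
  have h3 := mul_le_mul_of_nonneg_left ((le_abs_self _).trans h1) hS
  have h4 := mul_le_mul_of_nonneg_left ((neg_le_abs _).trans h2) (sq_nonneg (∑ i, b i x ^ 2))
  have e : 4 * (∑ i, b i x ^ 2) * (∑ j, b j x *
        ((∑ i, b i x * pd8 (u j) i x) - (∑ i, u i x * pd8 (b j) i x)
          - b j x * ∑ i, pd8 (u i) i x))
        + ∑ i, (u i x * pd8 f i x + f x * pd8 (u i) i x)
      = 4 * ((∑ i, b i x ^ 2) * ∑ j, b j x * ∑ i, b i x * pd8 (u j) i x)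
        + 3 * ((∑ i, b i x ^ 2) ^ 2 * -∑ i, pd8 (u i) i x) := by
    have hpf' : ∀ i, pd8 f i x = 4 * (∑ i, b i x ^ 2) * ∑ j, b j x * pd8 (b j) i x := fun i =>
      pd8_sum_sq_sq hb i x
    simp only [hpf']
    simp only [hf, Fin.sum_univ_two]
    ring
  refine e.trans_le ?_
  nlinarith

theorem le_mul_rpow_of_sq_le {I U X A G K : ℝ} (hK : 0 ≤ K) (hU : 0 ≤ U) (hA : 0 ≤ A) (hG : 0 ≤ G)
    (hI : I ^ 2 ≤ U * X) (hX : X ≤ K ^ 3 * A * G ^ 3) :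
    I ≤ (10 + √(K ^ 3)) * U ^ ((1 : ℝ) / 2) * A ^ ((1 : ℝ) / 2) * G ^ ((3 : ℝ) / 2) := by
  have hG3 : G ^ ((3 : ℝ) / 2) = √(G ^ 3) := by
    rw [Real.sqrt_eq_rpow, ← Real.rpow_natCast, ← Real.rpow_mul hG]
    norm_num
  rw [hG3, ← Real.sqrt_eq_rpow, ← Real.sqrt_eq_rpow]
  calc I ≤ √(U * (K ^ 3 * A * G ^ 3)) :=
        Real.le_sqrt_of_sq_le (hI.trans (mul_le_mul_of_nonneg_left hX hU))
    _ = √(K ^ 3) * √U * √A * √(G ^ 3) := by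
        rw [Real.sqrt_mul hU, Real.sqrt_mul (by positivity), Real.sqrt_mul (by positivity)]
        ring
    _ ≤ _ := by
        gcongr
        linarith

theorem exists_setIntegral_norm_grad_mul_le : ∃ K : ℝ, 0 < K ∧
    ∀ (R : ℝ) (u b : Fin 2 → E8 → ℝ), 0 < R → (∀ i, ContDiff ℝ 1 (u i)) →
    (∀ i, ContDiff ℝ 1 (b i)) → (∀ x ∈ sphere (0 : E8) R, ∀ i, b i x = 0) →
    ∫ x in ball (0 : E8) R, √(∑ i, ∑ j, pd8 (u j) i x ^ 2) * (∑ i, b i x ^ 2) ^ 2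
      ≤ (10 + √(K ^ 3)) * (∫ x in ball (0 : E8) R, ∑ i, ∑ j, pd8 (u j) i x ^ 2) ^ ((1 : ℝ) / 2)
        * (∫ x in ball (0 : E8) R, ∑ i, b i x ^ 2) ^ ((1 : ℝ) / 2)
        * (∫ x in ball (0 : E8) R, ∑ i, ∑ j, pd8 (b j) i x ^ 2) ^ ((3 : ℝ) / 2) := by
  obtain ⟨K, hK, hGN⟩ := exists_setIntegral_pow_four_le
  refine ⟨K, hK, fun R u b hR hu hb h0 => ?_⟩
  have hbc : ∀ i, Continuous (b i) := fun i => (hb i).continuous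
  have hpu : ∀ i j, Continuous (pd8 (u j) i) := fun i j => continuous_pd8 (hu j) i
  have hCS := sq_setIntegral_mul_le (f := fun x => √(∑ i, ∑ j, pd8 (u j) i x ^ 2))
    (g := fun x => (∑ i, b i x ^ 2) ^ 2) (by fun_prop) (by fun_prop) R
  have hsq : ∀ x, √(∑ i, ∑ j, pd8 (u j) i x ^ 2) ^ 2 = ∑ i, ∑ j, pd8 (u j) i x ^ 2 := fun x =>
    Real.sq_sqrt (by positivity)
  simp only [hsq] at hCS
  exact le_mul_rpow_of_sq_le hK.le (integral_nonneg fun x => by positivity)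
    (integral_nonneg fun x => by positivity) (integral_nonneg fun x => by positivity) hCS
    (hGN R b hR hb h0)

/-- Differential inequality for the L⁴ norm of the non-resistive magnetic field
(estimate (3.17) in the proof of Lemma 3.3). -/
theorem stmt8 :
    ∃ C > 0, ∀ (R T : ℝ), 0 < R → 0 < T →
    ∀ (u b : ℝ → E8 → E8),
      (∀ j : Fin 2, ContDiff ℝ (⊤ : ℕ∞) (fun p : ℝ × E8 => u p.1 p.2 j)) →
      (∀ j : Fin 2, ContDiff ℝ (⊤ : ℕ∞) (fun p : ℝ × E8 => b p.1 p.2 j)) →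
      (∀ t ∈ Set.Icc 0 T, ∀ x ∈ sphere (0 : E8) R, u t x = 0 ∧ b t x = 0) →
      (∀ t ∈ Set.Icc 0 T, ∀ x ∈ ball (0 : E8) R, ∀ j : Fin 2,
        deriv (fun s => b s x j) t
          - (∑ i, b t x i * pd8 (fun y => u t y j) i x)
          + (∑ i, u t x i * pd8 (fun y => b t y j) i x)
          + b t x j * (∑ i, pd8 (fun y => u t y i) i x) = 0) →
      ∀ t ∈ Set.Icc 0 T, ∀ D : ℝ,
        HasDerivAt (fun s => ∫ x in ball (0 : E8) R, (∑ i, (b s x i) ^ 2) ^ 2) D t →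
        D ≤ C * (∫ x in ball (0 : E8) R,
              Real.sqrt (∑ i, ∑ j, (pd8 (fun y => u t y j) i x) ^ 2)
                * (∑ i, (b t x i) ^ 2) ^ 2)
        ∧ (∫ x in ball (0 : E8) R,
              Real.sqrt (∑ i, ∑ j, (pd8 (fun y => u t y j) i x) ^ 2)
                * (∑ i, (b t x i) ^ 2) ^ 2)
            ≤ C * (∫ x in ball (0 : E8) R,
                    ∑ i, ∑ j, (pd8 (fun y => u t y j) i x) ^ 2) ^ ((1 : ℝ) / 2)
                * (∫ x in ball (0 : E8) R, ∑ i, (b t x i) ^ 2) ^ ((1 : ℝ) / 2)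
                * (∫ x in ball (0 : E8) R,
                    ∑ i, ∑ j, (pd8 (fun y => b t y j) i x) ^ 2) ^ ((3 : ℝ) / 2) := by
  obtain ⟨K, hK, hGN⟩ := exists_setIntegral_norm_grad_mul_le
  refine ⟨10 + √(K ^ 3), by positivity, fun R T hR _ u b hu hb h0 hpde t ht D hD => ?_⟩
  have hu1 : ∀ j : Fin 2, ContDiff ℝ 1 fun y => u t y j := fun j =>
    ((hu j).of_le (by simp)).comp (contDiff_prodMk_right t)
  have hb1' : ∀ j : Fin 2, ContDiff ℝ 1 fun p : ℝ × E8 => b p.1 p.2 j := fun j =>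
    (hb j).of_le (by simp)
  have hb1 : ∀ j : Fin 2, ContDiff ℝ 1 fun y => b t y j := fun j =>
    (hb1' j).comp (contDiff_prodMk_right t)
  have hb0 : ∀ x ∈ sphere (0 : E8) R, ∀ i, b t x i = 0 := fun x hx i => by
    simp [(h0 t ht x hx).2]
  have hI : 0 ≤ ∫ x in ball (0 : E8) R,
      √(∑ i, ∑ j, (pd8 (fun y => u t y j) i x) ^ 2) * (∑ i, (b t x i) ^ 2) ^ 2 :=
    integral_nonneg fun x => by positivity
  have hK0 := Real.sqrt_nonneg (K ^ 3)
  constructor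
  · have hD' := hasDerivAt_setIntegral_ball
      (F := fun p : ℝ × E8 => (∑ i, (b p.1 p.2 i) ^ 2) ^ 2) (by fun_prop) R t
    rw [hD.unique hD']
    have hle := setIntegral_stretching_transport_le hR hu1 hb1 hb0
    calc _ = _ := setIntegral_congr_fun measurableSet_ball fun x hx => ?_
      _ ≤ _ := hle
      _ ≤ _ := mul_le_mul_of_nonneg_right (by linarith) hI
    have hdb : ∀ j : Fin 2, HasDerivAt (fun s => b s x j) (deriv (fun s => b s x j) t) t :=
      fun j => (((hb1' j).comp (contDiff_prodMk_left x)).differentiable one_ne_zero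
        t).hasDerivAt
    have hd := (hasFDerivAt_sum_sq_sq fun j => (hdb j).hasFDerivAt).hasDerivAt.deriv
    refine hd.trans ?_
    have hj : ∀ j, deriv (fun s => b s x j) t
        = (∑ i, b t x i * pd8 (fun y => u t y j) i x)
          - (∑ i, u t x i * pd8 (fun y => b t y j) i x)
          - b t x j * (∑ i, pd8 (fun y => u t y i) i x) := fun j => by
      linarith [hpde t ht x hx j]
    simp only [← hj]
    simp [Fin.sum_univ_two]
    ring
  · exact hGN R (fun j y => u t y j) (fun j y => b t y j) hR hu1 hb1 hb0

end
end

section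
/- Let $\mathbf{b}, \mathbf{u}$ be smooth with $\mathbf{b}_t - \mathbf{b}\cdot\nabla\mathbf{u} + \mathbf{u}\cdot\nabla\mathbf{b} + \mathbf{b}\,\mathrm{div}\,\mathbf{u} = 0$ on $B_R \times (0,T)$, and let $a > 1$, $\bar{x}(x) = (e+|x|^2)^{1/2}\log^{1+\eta_0}(e+|x|^2)$ with $\eta_0 > 0$. Then the weighted field $\mathbf{b}\bar{x}^a$ satisfies $\partial_t(\mathbf{b}\bar{x}^a) + \mathbf{u}\cdot\nabla(\mathbf{b}\bar{x}^a) - a(\mathbf{u}\cdot\nabla\log\bar{x})\mathbf{b}\bar{x}^a + \mathbf{b}\bar{x}^a\,\mathrm{div}\,\mathbf{u} = (\mathbf{b}\bar{x}^a)\cdot\nabla\mathbf{u}$ pointwise, and consequently for every $r \in [2,q]$, $\frac{d}{dt}\|\mathbf{b}\bar{x}^a\|_{L^r(B_R)} \le C\left(\|\nabla\mathbf{u}\|_{L^\infty} + \|\mathbf{u}\cdot\nabla\log\bar{x}\|_{L^\infty}\right)\|\mathbf{b}\bar{x}^a\|_{L^r(B_R)}$ for a constant $C$ depending only on $a$ and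 $r$. -/
open MeasureTheory Metric Real

noncomputable section

abbrev E12 := EuclideanSpace ℝ (Fin 2)

def pd12 (f : E12 → ℝ) (i : Fin 2) (x : E12) : ℝ :=
  fderiv ℝ f x (EuclideanSpace.single i 1)

def div12 (v : E12 → Fin 2 → ℝ) (x : E12) : ℝ :=
  ∑ i, pd12 (fun y => v y i) i x

def barx12 (η₀ : ℝ) (x : E12) : ℝ :=
  Real.sqrt (Real.exp 1 + ‖x‖ ^ 2) * Real.log (Real.exp 1 + ‖x‖ ^ 2) ^ (1 + η₀)

/-- Extending by zero a `C¹` function that vanishes on a sphere gives a Lipschitz function. -/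
lemma exists_lipschitzWith_indicator_ball {E : Type*} [NormedAddCommGroup E] [NormedSpace ℝ E]
    [FiniteDimensional ℝ E] {f : E → ℝ} (hf : ContDiff ℝ 1 f) {R : ℝ}
    (hR : ∀ x ∈ sphere (0 : E) R, f x = 0) :
    ∃ K, LipschitzWith K ((ball (0 : E) R).indicator f) := by
  obtain ⟨K, hK⟩ := hf.contDiffOn.exists_lipschitzOnWith one_ne_zero
    (convex_closedBall (0 : E) R) (isCompact_closedBall _ _)
  have crossing : ∀ x ∈ ball (0 : E) R, ∀ y ∉ ball (0 : E) R, dist (f x) 0 ≤ K * dist x y := by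
    intro x hx y hy
    rw [mem_ball_zero_iff] at hx hy
    obtain ⟨s, hs, hs'⟩ : R ∈ (fun s : ℝ ↦ ‖AffineMap.lineMap x y s‖) '' Set.Icc (0 : ℝ) 1 :=
      intermediate_value_Icc zero_le_one
        ((AffineMap.lineMap_continuous (R := ℝ)).norm.continuousOn) (by simp [hx.le, not_lt.1 hy])
    have hz : (AffineMap.lineMap x y s : E) ∈ sphere (0 : E) R := by simpa using hs'
    rw [← hR _ hz]
    refine (hK.dist_le_mul x (by simpa using hx.le) _ (sphere_subset_closedBall hz)).trans ?_
    gcongr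
    rw [dist_left_lineMap, Real.norm_of_nonneg hs.1]
    exact mul_le_of_le_one_left dist_nonneg hs.2
  refine ⟨K, LipschitzWith.of_dist_le_mul fun x y ↦ ?_⟩
  by_cases hx : x ∈ ball (0 : E) R <;> by_cases hy : y ∈ ball (0 : E) R
  · simpa [hx, hy] using hK.dist_le_mul x (ball_subset_closedBall hx) y (ball_subset_closedBall hy)
  · simpa [Set.indicator_of_mem hx, Set.indicator_of_notMem hy] using crossing x hx y hy
  · rw [dist_comm, dist_comm x]
    simpa [Set.indicator_of_mem hy, Set.indicator_of_notMem hx] using crossing y hy x hx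
  · simp only [Set.indicator_of_notMem hx, Set.indicator_of_notMem hy, dist_self]
    positivity

/-- The integral over a ball of a directional derivative of a `C¹` function vanishing on the
bounding sphere is zero. -/
lemma setIntegral_ball_fderiv_eq_zero {E : Type*} [NormedAddCommGroup E] [InnerProductSpace ℝ E]
    [FiniteDimensional ℝ E] [Nontrivial E] [MeasurableSpace E] [BorelSpace E]
    (μ : Measure E) [μ.IsAddHaarMeasure] {f : E → ℝ} (hf : ContDiff ℝ 1 f) {R : ℝ} (hR : 0 < R)
    (hfR : ∀ x ∈ sphere (0 : E) R, f x = 0) (v : E) :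
    ∫ x in ball (0 : E) R, fderiv ℝ f x v ∂μ = 0 := by
  obtain ⟨K, hK⟩ := exists_lipschitzWith_indicator_ball hf hfR
  let χ : ContDiffBump (0 : E) := ⟨R, R + 1, hR, by linarith⟩
  have hχ1 : ContDiff ℝ 1 χ := χ.contDiff
  obtain ⟨D, hD⟩ := hχ1.lipschitzWith_of_hasCompactSupport χ.hasCompactSupport one_ne_zero
  have key := hK.integral_lineDeriv_mul_eq (μ := μ) hD χ.hasCompactSupport v
  have hright : ∀ x, lineDeriv ℝ χ x (-v) * (ball (0 : E) R).indicator f x = 0 := by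
    intro x
    by_cases hx : x ∈ ball (0 : E) R
    · have hev : (χ : E → ℝ) =ᶠ[nhds x] fun _ ↦ (1 : ℝ) := by
        filter_upwards [isOpen_ball.mem_nhds hx] with y hy
        exact χ.one_of_mem_closedBall (ball_subset_closedBall hy)
      rw [(hχ1.differentiable one_ne_zero).differentiableAt.lineDeriv_eq_fderiv, hev.fderiv_eq]
      simp
    · simp [Set.indicator_of_notMem hx]
  rw [integral_congr_ae (Filter.Eventually.of_forall hright), integral_zero] at key
  rw [← key, ← integral_indicator measurableSet_ball]
  have hsphere : ∀ᵐ x ∂μ, x ∉ sphere (0 : E) R :=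
    measure_eq_zero_iff_ae_notMem.1 (Measure.addHaar_sphere μ 0 R)
  refine integral_congr_ae ?_
  filter_upwards [hsphere] with x hx
  by_cases hxb : x ∈ ball (0 : E) R
  · have hev : (ball (0 : E) R).indicator f =ᶠ[nhds x] f := by
      filter_upwards [isOpen_ball.mem_nhds hxb] with y hy
      exact Set.indicator_of_mem hy f
    have hd : DifferentiableAt ℝ ((ball (0 : E) R).indicator f) x :=
      (hf.differentiable one_ne_zero).differentiableAt.congr_of_eventuallyEq hev
    rw [Set.indicator_of_mem hxb, hd.lineDeriv_eq_fderiv, hev.fderiv_eq,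
      χ.one_of_mem_closedBall (ball_subset_closedBall hxb), mul_one]
  · have hxc : x ∈ (closedBall (0 : E) R)ᶜ := by
      intro h
      rw [← ball_union_sphere] at h
      exact h.elim hxb hx
    have hev : (ball (0 : E) R).indicator f =ᶠ[nhds x] fun _ ↦ (0 : ℝ) := by
      filter_upwards [isClosed_closedBall.isOpen_compl.mem_nhds hxc] with y hy
      exact Set.indicator_of_notMem (fun h ↦ hy (ball_subset_closedBall h)) f
    have hd : DifferentiableAt ℝ ((ball (0 : E) R).indicator f) x :=
      (differentiableAt_const (0 : ℝ)).congr_of_eventuallyEq hev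
    rw [Set.indicator_of_notMem hxb, hd.lineDeriv_eq_fderiv, hev.fderiv_eq]
    simp

/-- Differentiation under the integral sign over a ball for a jointly `C¹` integrand. -/
lemma hasDerivAt_setIntegral_ball_s12 {E : Type*} [NormedAddCommGroup E] [NormedSpace ℝ E]
    [FiniteDimensional ℝ E] [MeasurableSpace E] [BorelSpace E]
    (μ : Measure E) [IsFiniteMeasureOnCompacts μ] {G : ℝ × E → ℝ} (hG : ContDiff ℝ 1 G)
    (R t : ℝ) :
    HasDerivAt (fun s ↦ ∫ x in ball (0 : E) R, G (s, x) ∂μ)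
      (∫ x in ball (0 : E) R, fderiv ℝ G (t, x) (1, 0) ∂μ) t := by
  have hG' : Continuous fun p ↦ fderiv ℝ G p (1, 0) :=
    (hG.continuous_fderiv one_ne_zero).clm_apply continuous_const
  have hfin : μ (ball (0 : E) R) ≠ ⊤ := measure_ball_lt_top.ne
  obtain ⟨M, hM⟩ := ((isCompact_Icc (a := t - 1) (b := t + 1)).prod
    (isCompact_closedBall (0 : E) R)).exists_bound_of_continuousOn hG'.continuousOn
  have hcont : ∀ s, Continuous fun x ↦ G (s, x) := fun s ↦ hG.continuous.comp (by fun_prop)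
  refine (hasDerivAt_integral_of_dominated_loc_of_deriv_le (bound := fun _ ↦ M)
    (F := fun s x ↦ G (s, x)) (F' := fun s x ↦ fderiv ℝ G (s, x) (1, 0))
    (Icc_mem_nhds (by linarith : t - 1 < t) (by linarith : t < t + 1)) ?_ ?_ ?_ ?_ ?_ ?_).2
  · exact .of_forall fun s ↦ (hcont s).aestronglyMeasurable
  · exact ((hcont t).continuousOn.integrableOn_compact (isCompact_closedBall (0 : E) R)).mono_set
      ball_subset_closedBall
  · exact (hG'.comp (by fun_prop : Continuous fun x : E ↦ (t, x))).aestronglyMeasurable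
  · filter_upwards [ae_restrict_mem measurableSet_ball] with x hx s hs
    exact hM (s, x) ⟨hs, ball_subset_closedBall hx⟩
  · exact integrableOn_const hfin
  · refine .of_forall fun x s _ ↦ ?_
    have h := (hG.differentiable one_ne_zero (s, x)).hasFDerivAt.comp_hasDerivAt s
      ((hasDerivAt_id s).prodMk (hasDerivAt_const s x))
    exact h

lemma barx12_pos (η₀ : ℝ) (x : E12) : 0 < barx12 η₀ x := by
  have h1 : 1 < Real.exp 1 + ‖x‖ ^ 2 := by
    nlinarith [Real.one_lt_exp_iff.2 (zero_lt_one' ℝ), sq_nonneg ‖x‖]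
  have h2 := Real.log_pos h1
  unfold barx12
  positivity

lemma contDiff_barx12 (η₀ : ℝ) : ContDiff ℝ (⊤ : ℕ∞) (barx12 η₀) := by
  have h1 : ∀ x : E12, 1 < Real.exp 1 + ‖x‖ ^ 2 := fun x ↦ by
    nlinarith [Real.one_lt_exp_iff.2 (zero_lt_one' ℝ), sq_nonneg ‖x‖]
  have h0 : ContDiff ℝ (⊤ : ℕ∞) fun x : E12 ↦ Real.exp 1 + ‖x‖ ^ 2 :=
    contDiff_const.add (contDiff_norm_sq ℝ)
  exact (h0.sqrt fun x ↦ by linarith [h1 x]).mul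
    ((h0.log fun x ↦ by linarith [h1 x]).rpow_const_of_ne fun x ↦ (Real.log_pos (h1 x)).ne')

lemma pd12_mul {f g : E12 → ℝ} {x : E12} (hf : DifferentiableAt ℝ f x)
    (hg : DifferentiableAt ℝ g x) (i : Fin 2) :
    pd12 (fun y ↦ f y * g y) i x = pd12 f i x * g x + f x * pd12 g i x := by
  simp only [pd12, fderiv_fun_mul hf hg, add_apply,
    smul_apply, smul_eq_mul]
  ring

/-- Logarithmic differentiation of a power. -/
lemma pd12_rpow_eq {f : E12 → ℝ} {x : E12} (hf : DifferentiableAt ℝ f x) (hx : 0 < f x)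
    (a : ℝ) (i : Fin 2) :
    pd12 (fun y ↦ f y ^ a) i x = a * pd12 (fun y ↦ Real.log (f y)) i x * f x ^ a := by
  have h1 := (hf.hasFDerivAt.rpow_const (p := a) (.inl hx.ne')).fderiv
  have h2 := (hf.hasFDerivAt.log hx.ne').fderiv
  simp only [pd12, h1, h2, smul_apply, smul_eq_mul, Real.rpow_sub_one hx.ne']
  field_simp

/-- The weight `x̄^a` commutes with transport up to the term `a (u · ∇ log x̄)`. -/
lemma transport_mul_barx12_rpow {a η₀ : ℝ} {u b : ℝ → E12 → E12} {t : ℝ} {x : E12} {j : Fin 2}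
    (hb : DifferentiableAt ℝ (fun y ↦ b t y j) x)
    (h : deriv (fun s => b s x j) t
          - (∑ i, b t x i * pd12 (fun y => u t y j) i x)
          + (∑ i, u t x i * pd12 (fun y => b t y j) i x)
          + b t x j * div12 (fun y i => u t y i) x = 0) :
    deriv (fun s => b s x j * barx12 η₀ x ^ a) t
          + (∑ i, u t x i * pd12 (fun y => b t y j * barx12 η₀ y ^ a) i x)
          - a * (∑ i, u t x i * pd12 (fun y => Real.log (barx12 η₀ y)) i x)
              * (b t x j * barx12 η₀ x ^ a)
          + b t x j * barx12 η₀ x ^ a * div12 (fun y i => u t y i) x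
        = ∑ i, b t x i * barx12 η₀ x ^ a * pd12 (fun y => u t y j) i x := by
  have hw : DifferentiableAt ℝ (barx12 η₀) x :=
    (contDiff_barx12 η₀).differentiable (by simp) x
  have hpd : ∀ i, pd12 (fun y => b t y j * barx12 η₀ y ^ a) i x
      = pd12 (fun y => b t y j) i x * barx12 η₀ x ^ a
        + b t x j * (a * pd12 (fun y => Real.log (barx12 η₀ y)) i x * barx12 η₀ x ^ a) := by
    intro i
    rw [pd12_mul hb (hw.rpow_const (.inl (barx12_pos η₀ x).ne')),
      pd12_rpow_eq hw (barx12_pos η₀ x)]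
  simp only [hpd, deriv_mul_const_field, Fin.sum_univ_two] at h ⊢
  linear_combination barx12 η₀ x ^ a * h

/-- The pointwise growth bound for `‖B‖ ^ r` along a field whose material derivative is
`B · M + a L B - (tr M) B`. -/
lemma norm_rpow_growth_le {a r : ℝ} (ha : 0 ≤ a) (hr : 1 ≤ r) {B w : E12}
    {M : Fin 2 → Fin 2 → ℝ} {L K₁ K₂ : ℝ}
    (hM : Real.sqrt (∑ i, ∑ j, M i j ^ 2) ≤ K₁) (hL : |L| ≤ K₂)
    (hw : ∀ j, w j = ∑ i, B i * M i j + a * L * B j - B j * ∑ i, M i i) :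
    r * ‖B‖ ^ (r - 2) * inner ℝ B w + (∑ i, M i i) * ‖B‖ ^ r
      ≤ (r * a + 4 * r + 2) * (K₁ + K₂) * ‖B‖ ^ r := by
  have hK₁ : 0 ≤ K₁ := (Real.sqrt_nonneg _).trans hM
  have hK₂ : 0 ≤ K₂ := (abs_nonneg _).trans hL
  have hM' : ∑ i, ∑ j, M i j ^ 2 ≤ K₁ ^ 2 := (Real.sqrt_le_left hK₁).1 hM
  have hent : ∀ i j, |M i j| ≤ K₁ := fun i j ↦ by
    refine abs_le_of_sq_le_sq (le_trans ?_ hM') hK₁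
    exact (Finset.single_le_sum (f := fun j ↦ M i j ^ 2) (fun _ _ ↦ sq_nonneg _)
      (Finset.mem_univ j)).trans (Finset.single_le_sum (f := fun i ↦ ∑ j, M i j ^ 2)
        (fun _ _ ↦ Finset.sum_nonneg fun _ _ ↦ sq_nonneg _) (Finset.mem_univ i))
  have hnorm : ‖B‖ ^ 2 = B 0 ^ 2 + B 1 ^ 2 := by
    rw [EuclideanSpace.real_norm_sq_eq, Fin.sum_univ_two]
  have htr : |∑ i, M i i| ≤ 2 * K₁ := by
    rw [Fin.sum_univ_two]
    linarith [abs_add_le (M 0 0) (M 1 1), hent 0 0, hent 1 1]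
  have hterm : ∀ i j, B i * M i j * B j ≤ K₁ * ((B i ^ 2 + B j ^ 2) / 2) := fun i j ↦ by
    calc B i * M i j * B j ≤ |B i * M i j * B j| := le_abs_self _
      _ = |M i j| * (|B i| * |B j|) := by rw [abs_mul, abs_mul]; ring
      _ ≤ K₁ * ((B i ^ 2 + B j ^ 2) / 2) := by
        gcongr
        · exact hent i j
        · nlinarith [sq_nonneg (|B i| - |B j|), sq_abs (B i), sq_abs (B j)]
  have hinner : inner ℝ B w ≤ (4 * K₁ + a * K₂) * ‖B‖ ^ 2 := by
    have hexp : inner ℝ B w = ∑ i, ∑ j, B i * M i j * B j + (a * L - ∑ i, M i i) * ‖B‖ ^ 2 := by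
      rw [hnorm]
      simp only [PiLp.inner_apply, hw, Fin.sum_univ_two]
      simp
      ring
    have h1 : ∑ i, ∑ j, B i * M i j * B j ≤ 2 * K₁ * ‖B‖ ^ 2 := by
      rw [hnorm]
      simp only [Fin.sum_univ_two]
      linarith [hterm 0 0, hterm 0 1, hterm 1 0, hterm 1 1]
    have h2 : a * L ≤ a * K₂ := mul_le_mul_of_nonneg_left ((le_abs_self L).trans hL) ha
    have h3 : a * L - ∑ i, M i i ≤ a * K₂ + 2 * K₁ := by linarith [neg_abs_le (∑ i, M i i)]
    rw [hexp]
    nlinarith [mul_le_mul_of_nonneg_right h3 (sq_nonneg ‖B‖)]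
  have hpow : ‖B‖ ^ (r - 2) * ‖B‖ ^ 2 = ‖B‖ ^ r := by
    rw [← Real.rpow_natCast ‖B‖ 2, ← Real.rpow_add' (norm_nonneg B) (by norm_num; linarith)]
    norm_num
  have hr0 : 0 ≤ r := by linarith
  have hBr : 0 ≤ ‖B‖ ^ r := by positivity
  calc r * ‖B‖ ^ (r - 2) * inner ℝ B w + (∑ i, M i i) * ‖B‖ ^ r
      ≤ r * ‖B‖ ^ (r - 2) * ((4 * K₁ + a * K₂) * ‖B‖ ^ 2) + 2 * K₁ * ‖B‖ ^ r := by
        gcongr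
        exact (le_abs_self _).trans htr
    _ = (r * (4 * K₁ + a * K₂) + 2 * K₁) * ‖B‖ ^ r := by rw [← hpow]; ring
    _ ≤ (r * a + 4 * r + 2) * (K₁ + K₂) * ‖B‖ ^ r := by
        gcongr
        nlinarith [mul_nonneg (mul_nonneg hr0 ha) hK₁, mul_nonneg hr0 hK₂]

/-- A differential inequality `F' ≤ c r F` for `F ≥ 0` passes to `F ^ (1 / r)`. -/
lemma deriv_rpow_one_div_le {F : ℝ → ℝ} {F' c r D t : ℝ} (hr : 0 < r) (hF : ∀ s, 0 ≤ F s)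
    (hF' : HasDerivAt F F' t) (hle : F' ≤ c * r * F t)
    (hD : HasDerivAt (fun s ↦ F s ^ (1 / r)) D t) : D ≤ c * F t ^ (1 / r) := by
  rcases (hF t).eq_or_lt with h0 | hpos
  · have hz : F t ^ (1 / r) = 0 := by rw [← h0, Real.zero_rpow (by positivity)]
    have hmin : IsLocalMin (fun s ↦ F s ^ (1 / r)) t :=
      .of_forall fun s ↦ by simpa only [hz] using Real.rpow_nonneg (hF s) _
    rw [hmin.hasDerivAt_eq_zero hD, hz, mul_zero]
  · rw [hD.unique (hF'.rpow_const (.inl hpos.ne')), Real.rpow_sub_one hpos.ne']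
    calc F' * (1 / r) * (F t ^ (1 / r) / F t)
        ≤ c * r * F t * (1 / r) * (F t ^ (1 / r) / F t) := by gcongr
      _ = c * F t ^ (1 / r) := by field_simp

lemma continuous_pd12 {f : E12 → ℝ} (hf : ContDiff ℝ 1 f) (i : Fin 2) :
    Continuous (pd12 f i) :=
  (hf.continuous_fderiv one_ne_zero).clm_apply continuous_const

/-- The material derivative splits into the time derivative and the transport term. -/
lemma fderiv_apply_one {f : ℝ × E12 → ℝ} {t : ℝ} {x : E12} (hf : DifferentiableAt ℝ f (t, x))
    (v : E12) :
    fderiv ℝ f (t, x) (1, v)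
      = fderiv ℝ f (t, x) (1, 0) + ∑ i, v i * pd12 (fun y ↦ f (t, y)) i x := by
  have hpd : ∀ i, pd12 (fun y ↦ f (t, y)) i x
      = fderiv ℝ f (t, x) (0, EuclideanSpace.single i 1) := by
    intro i
    have h := hf.hasFDerivAt.comp x
      ((hasFDerivAt_const t x).prodMk (hasFDerivAt_id x))
    have h' : fderiv ℝ (fun y ↦ f (t, y)) x = _ := h.fderiv
    simp [pd12, h']
  have hdec : ((1 : ℝ), v) = (1, 0) + ∑ i, v i • ((0 : ℝ), EuclideanSpace.single i (1 : ℝ)) := by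
    refine Prod.ext (by simp) ?_
    ext j
    fin_cases j <;> simp [Fin.sum_univ_two]
  rw [hdec, map_add, map_sum]
  simp only [map_smul, smul_eq_mul, ← hpd]

/-- If the material derivative along `v`, which vanishes on the boundary, satisfies
`∂ₜ G + div (v G) ≤ c G` at time `t`, then `d/dt ∫ G ≤ c ∫ G`. -/
lemma setIntegral_fderiv_time_le {G : ℝ × E12 → ℝ} (hG : ContDiff ℝ 1 G) {v : E12 → E12}
    (hv : ∀ i, ContDiff ℝ 1 fun x ↦ v x i) {R t c : ℝ} (hR : 0 < R)
    (hvR : ∀ x ∈ sphere (0 : E12) R, v x = 0)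
    (hle : ∀ x ∈ ball (0 : E12) R,
      fderiv ℝ G (t, x) (1, v x) + (∑ i, pd12 (fun y ↦ v y i) i x) * G (t, x) ≤ c * G (t, x)) :
    ∫ x in ball (0 : E12) R, fderiv ℝ G (t, x) (1, 0) ≤ c * ∫ x in ball (0 : E12) R, G (t, x) := by
  have hInt : ∀ {f : E12 → ℝ}, Continuous f → IntegrableOn f (ball (0 : E12) R) := fun hf ↦
    (hf.continuousOn.integrableOn_compact (isCompact_closedBall (0 : E12) R)).mono_set
      ball_subset_closedBall
  have hGt : ContDiff ℝ 1 fun x ↦ G (t, x) := hG.comp (contDiff_const.prodMk contDiff_id)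
  have hGd : Continuous fun x : E12 ↦ fderiv ℝ G (t, x) (1, 0) :=
    ((hG.continuous_fderiv one_ne_zero).comp (by fun_prop)).clm_apply continuous_const
  have hV : ∀ i, ContDiff ℝ 1 fun x ↦ v x i * G (t, x) := fun i ↦ (hv i).mul hGt
  have hzero : ∀ i, ∫ x in ball (0 : E12) R, pd12 (fun y ↦ v y i * G (t, y)) i x = 0 := fun i ↦
    setIntegral_ball_fderiv_eq_zero volume (hV i) hR (fun x hx ↦ by simp [hvR x hx]) _
  have hadd : ∫ x in ball (0 : E12) R, fderiv ℝ G (t, x) (1, 0)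
      = ∫ x in ball (0 : E12) R,
        (fderiv ℝ G (t, x) (1, 0) + ∑ i, pd12 (fun y ↦ v y i * G (t, y)) i x) := by
    rw [integral_add (hInt hGd)
        (hInt (continuous_finsetSum _ fun i _ ↦ continuous_pd12 (hV i) i)),
      integral_finsetSum _ fun i _ ↦ hInt (continuous_pd12 (hV i) i)]
    simp [hzero]
  rw [hadd, ← integral_const_mul]
  refine setIntegral_mono_on
    (hInt (hGd.add (continuous_finsetSum _ fun i _ ↦ continuous_pd12 (hV i) i)))
    (hInt (hGt.continuous.const_mul c)) measurableSet_ball fun x hx ↦ (le_of_eq ?_).trans (hle x hx)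
  rw [fderiv_apply_one (hG.differentiable one_ne_zero (t, x)) (v x)]
  simp only [Finset.sum_mul, add_assoc, ← Finset.sum_add_distrib]
  congr 1
  refine Finset.sum_congr rfl fun i _ ↦ ?_
  rw [pd12_mul ((hv i).differentiable one_ne_zero x) (hGt.differentiable one_ne_zero x)]
  ring

/-- Equation (3.40) and estimate (3.41): the transport identity for the weighted
magnetic field `b x̄^a` and the resulting differential inequality for its L^r norm. -/
theorem stmt12 (a q r η₀ : ℝ) (ha : 1 < a) (hη : 0 < η₀) (hq : 2 < q)
    (hr : r ∈ Set.Icc 2 q) :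
    ∃ C > 0, ∀ (R T : ℝ), 0 < R → 0 < T →
    ∀ (u b : ℝ → E12 → E12),
      (∀ j : Fin 2, ContDiff ℝ (⊤ : ℕ∞) (fun p : ℝ × E12 => u p.1 p.2 j)) →
      (∀ j : Fin 2, ContDiff ℝ (⊤ : ℕ∞) (fun p : ℝ × E12 => b p.1 p.2 j)) →
      (∀ t ∈ Set.Icc 0 T, ∀ x ∈ sphere (0 : E12) R, u t x = 0) →
      (∀ t ∈ Set.Ioo 0 T, ∀ x ∈ ball (0 : E12) R, ∀ j : Fin 2,
        deriv (fun s => b s x j) t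
          - (∑ i, b t x i * pd12 (fun y => u t y j) i x)
          + (∑ i, u t x i * pd12 (fun y => b t y j) i x)
          + b t x j * div12 (fun y i => u t y i) x = 0) →
      -- the transport identity for b x̄^a
      (∀ t ∈ Set.Ioo 0 T, ∀ x ∈ ball (0 : E12) R, ∀ j : Fin 2,
        deriv (fun s => b s x j * barx12 η₀ x ^ a) t
          + (∑ i, u t x i * pd12 (fun y => b t y j * barx12 η₀ y ^ a) i x)
          - a * (∑ i, u t x i * pd12 (fun y => Real.log (barx12 η₀ y)) i x)
              * (b t x j * barx12 η₀ x ^ a)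
          + b t x j * barx12 η₀ x ^ a * div12 (fun y i => u t y i) x
        = ∑ i, b t x i * barx12 η₀ x ^ a * pd12 (fun y => u t y j) i x)
      -- the L^r differential inequality
      ∧ (∀ t ∈ Set.Ioo 0 T, ∀ K₁ K₂ D : ℝ,
          (∀ x ∈ ball (0 : E12) R,
            Real.sqrt (∑ i, ∑ j, (pd12 (fun y => u t y j) i x) ^ 2) ≤ K₁) →
          (∀ x ∈ ball (0 : E12) R,
            |∑ i, u t x i * pd12 (fun y => Real.log (barx12 η₀ y)) i x| ≤ K₂) →
          HasDerivAt (fun s => (∫ x in ball (0 : E12) R,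
              (Real.sqrt (∑ j, (b s x j) ^ 2) * barx12 η₀ x ^ a) ^ r) ^ (1 / r)) D t →
          D ≤ C * (K₁ + K₂) *
              (∫ x in ball (0 : E12) R,
                (Real.sqrt (∑ j, (b t x j) ^ 2) * barx12 η₀ x ^ a) ^ r) ^ (1 / r)) := by
  have hr2 : 2 ≤ r := hr.1
  have hr0 : 0 < r := by linarith
  refine ⟨(r * a + 4 * r + 2) / r, by positivity, ?_⟩
  intro R T hR _ u b hu hb huR heq
  have hslice : ∀ {f : ℝ × E12 → ℝ}, ContDiff ℝ (⊤ : ℕ∞) f → ∀ t,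
      ContDiff ℝ 1 fun x ↦ f (t, x) := fun hf t ↦
    (hf.of_le (by simp)).comp (contDiff_const.prodMk contDiff_id)
  have htransport : ∀ t ∈ Set.Ioo 0 T, ∀ x ∈ ball (0 : E12) R, ∀ j : Fin 2, _ :=
    fun t ht x hx j ↦ transport_mul_barx12_rpow (a := a) (η₀ := η₀)
      ((hslice (hb j) t).differentiable one_ne_zero x) (heq t ht x hx j)
  refine ⟨htransport, fun t ht K₁ K₂ D hK₁ hK₂ hD ↦ ?_⟩
  let B : ℝ × E12 → E12 := fun p ↦ WithLp.toLp 2 fun j ↦ b p.1 p.2 j * barx12 η₀ p.2 ^ a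
  have hBj : ∀ j, ContDiff ℝ 1 fun p ↦ B p j := fun j ↦
    ((hb j).of_le (by simp)).mul
      ((((contDiff_barx12 η₀).of_le (by simp)).comp contDiff_snd).rpow_const_of_ne
        fun p ↦ (barx12_pos η₀ p.2).ne')
  have hB : ContDiff ℝ 1 B := contDiff_euclidean.2 hBj
  have hG : ContDiff ℝ 1 fun p ↦ ‖B p‖ ^ r := hB.norm_rpow (by linarith)
  have hnorm : ∀ s x, Real.sqrt (∑ j, (b s x j) ^ 2) * barx12 η₀ x ^ a = ‖B (s, x)‖ := by
    intro s x
    have hW : 0 ≤ barx12 η₀ x ^ a := Real.rpow_nonneg (barx12_pos η₀ x).le a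
    simp only [EuclideanSpace.norm_eq, B, norm_mul, mul_pow, ← Finset.sum_mul, Real.norm_eq_abs,
      sq_abs]
    rw [Real.sqrt_mul (Finset.sum_nonneg fun _ _ ↦ sq_nonneg _), Real.sqrt_sq hW]
  simp only [hnorm] at hD ⊢
  refine deriv_rpow_one_div_le hr0 (fun s ↦ integral_nonneg fun x ↦ by positivity)
    (hasDerivAt_setIntegral_ball_s12 volume hG R t) ?_ hD
  have hc : (r * a + 4 * r + 2) / r * (K₁ + K₂) * r = (r * a + 4 * r + 2) * (K₁ + K₂) := by
    field_simp
  rw [hc]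
  refine setIntegral_fderiv_time_le hG (v := u t) (fun i ↦ hslice (hu i) t) hR
    (huR t ⟨ht.1.le, ht.2.le⟩) fun x hx ↦ ?_
  rw [(hB.differentiable one_ne_zero).fderiv_norm_rpow (by linarith)]
  refine norm_rpow_growth_le (M := fun i j ↦ pd12 (fun y ↦ u t y j) i x) (by linarith)
    (by linarith) (hK₁ x hx) (hK₂ x hx) fun j ↦ ?_
  have hcoord : fderiv ℝ B (t, x) (1, u t x) j = fderiv ℝ (fun p ↦ B p j) (t, x) (1, u t x) := by
    have h := ((EuclideanSpace.proj j : E12 →L[ℝ] ℝ).hasFDerivAt.comp (t, x)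
      (hB.differentiable one_ne_zero (t, x)).hasFDerivAt).fderiv
    exact (congrArg (fun l ↦ l (1, u t x)) h).symm
  have htime : deriv (fun s ↦ B (s, x) j) t = fderiv ℝ (fun p ↦ B p j) (t, x) (1, 0) :=
    (HasFDerivAt.comp_hasDerivAt (l := fun p ↦ B p j) t
      ((hBj j).differentiable one_ne_zero (t, x)).hasFDerivAt
      ((hasDerivAt_id t).prodMk (hasDerivAt_const t x))).deriv
  refine hcoord.trans ?_
  rw [fderiv_apply_one ((hBj j).differentiable one_ne_zero (t, x)), ← htime]
  have h := htransport t ht x hx j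
  simp only [B, div12] at h ⊢
  linarith

end
end

section
/- Let $\bar{x}(x) = (e+|x|^2)^{1/2}\log^{1+\eta_0}(e+|x|^2)$ with $\eta_0 > 0$. For every $0 < \delta < 1$ there exists a constant $C(\delta)$ such that for all smooth $\mathbf{u}$ on $B_R$ ($R \ge 1$) vanishing on the boundary: $\|\mathbf{u}\bar{x}^{-\delta}\|_{L^\infty(B_R)} \le C(\delta)\left(\|\mathbf{u}\bar{x}^{-\delta}\|_{L^{4/\delta}(B_R)} + \|\nabla\mathbf{u}\|_{L^3(B_R)} + \|\mathbf{u}\bar{x}^{-\delta}\|_{L^{4/\delta}(B_R)}\|\bar{x}^{-1}\nabla\bar{x}\|_{L^{12/(4-3\delta)}(B_R)}\right)$, and $\|\bar{x}^{-1}\nabla\bar{x}\|_{L^{12/(4-3\delta)}(\mathbb{R}^2)}$ is finite. -/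
open MeasureTheory Metric Real

noncomputable section

abbrev E13 := EuclideanSpace ℝ (Fin 2)

def barx13 (η₀ : ℝ) (x : E13) : ℝ :=
  Real.sqrt (Real.exp 1 + ‖x‖ ^ 2) * Real.log (Real.exp 1 + ‖x‖ ^ 2) ^ (1 + η₀)

section WeightedEstimate

open Measure Module Set
open scoped ENNReal

section Polar

variable {E : Type*} [NormedAddCommGroup E] [NormedSpace ℝ E] [MeasurableSpace E] [BorelSpace E]
  [FiniteDimensional ℝ E] [Nontrivial E]

theorem lintegral_eq_lintegral_toSphere (μ : Measure E) [μ.IsAddHaarMeasure] {f : E → ℝ≥0∞}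
    (hf : Measurable f) :
    ∫⁻ x, f x ∂μ = ∫⁻ θ : sphere (0 : E) 1,
      (∫⁻ r in Ioi (0 : ℝ), ENNReal.ofReal (r ^ (finrank ℝ E - 1)) * f (r • (θ : E)))
        ∂μ.toSphere := by
  have hm : Measurable fun p : sphere (0 : E) 1 × Ioi (0 : ℝ) => f ((p.2 : ℝ) • (p.1 : E)) := by
    fun_prop
  calc ∫⁻ x, f x ∂μ = ∫⁻ x : ({(0)}ᶜ : Set E), f x ∂(μ.comap (↑)) := by
        rw [lintegral_subtype_comap (measurableSet_singleton _).compl, restrict_compl_singleton]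
    _ = ∫⁻ p, f ((p.2 : ℝ) • (p.1 : E)) ∂μ.toSphere.prod (volumeIoiPow (finrank ℝ E - 1)) := by
        rw [← μ.measurePreserving_homeomorphUnitSphereProd.lintegral_comp_emb
          (Homeomorph.measurableEmbedding _)]
        refine lintegral_congr fun x => ?_
        rw [← homeomorphUnitSphereProd_symm_apply_coe, Homeomorph.symm_apply_apply]
    _ = _ := by
        rw [lintegral_prod _ hm.aemeasurable]
        refine lintegral_congr fun θ => ?_
        rw [volumeIoiPow, lintegral_withDensity_eq_lintegral_mul _ (by fun_prop) (by fun_prop),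
          ← lintegral_subtype_comap measurableSet_Ioi]
        rfl

end Polar

section Radial

variable {E F : Type*} [NormedAddCommGroup E] [NormedSpace ℝ E]
  [NormedAddCommGroup F] [NormedSpace ℝ F] [CompleteSpace F]

theorem enorm_le_lintegral_ray {v : E → F} (hv : ContDiff ℝ 1 v) {R : ℝ}
    (h0 : ∀ x ∈ sphere (0 : E) R, v x = 0) {x : E} (hx : x ∈ ball (0 : E) R) {θ : E}
    (hθ : ‖θ‖ = 1) :
    ‖v x‖ₑ ≤ ∫⁻ r in Ioo (0 : ℝ) 1,
      (ball (0 : E) R).indicator (fun y => ‖v y‖ₑ + ‖fderiv ℝ v y‖ₑ) (x + r • θ) := by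
  have hc : Continuous fun r : ℝ => x + r • θ := by fun_prop
  obtain ⟨T, ⟨⟨hT0, hT1⟩, hT⟩, hmin⟩ : ∃ T, IsLeast (Icc (0 : ℝ) 1 ∩
      ({r | R ≤ ‖x + r • θ‖} ∪ {1})) T := by
    refine IsCompact.exists_isLeast (isCompact_Icc.inter_right ?_) ⟨1, by simp⟩
    exact (isClosed_le continuous_const hc.norm).union isClosed_singleton
  have hlt : ∀ r ∈ Ico 0 T, ‖x + r • θ‖ < R := by
    intro r hr
    by_contra! h
    exact absurd (hmin ⟨⟨hr.1, hr.2.le.trans hT1⟩, Or.inl h⟩) (not_le.2 hr.2)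
  have hgT : (1 - T) • v (x + T • θ) = 0 := by
    rcases hT with hT | hT
    · have hne : (0 : ℝ) ≠ T := by
        rintro rfl
        simp at hT hx
        linarith
      have hle : closure (Ico 0 T) ⊆ {r : ℝ | ‖x + r • θ‖ ≤ R} :=
        closure_minimal (fun r hr => (hlt r hr).le) (isClosed_le hc.norm continuous_const)
      rw [closure_Ico hne] at hle
      rw [h0 _ (mem_sphere_zero_iff_norm.2 (le_antisymm (hle ⟨hT0, le_rfl⟩) hT)), smul_zero]
    · rw [mem_singleton_iff.1 hT]; simp
  let g' : ℝ → F := fun r =>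
    (1 - r) • fderiv ℝ v (x + r • θ) θ + (-1 : ℝ) • v (x + r • θ)
  have hderiv : ∀ r, HasDerivAt (fun r : ℝ => (1 - r) • v (x + r • θ)) (g' r) r := by
    intro r
    have h1 : HasDerivAt (fun r : ℝ => x + r • θ) θ r := by
      simpa using ((hasDerivAt_id r).smul_const θ).const_add x
    have h2 := ((hv.differentiable one_ne_zero) (x + r • θ)).hasFDerivAt.comp_hasDerivAt r h1
    exact ((hasDerivAt_id r).const_sub 1).smul h2
  have hcont : Continuous g' := by
    have h1 : Continuous fun r : ℝ => fderiv ℝ v (x + r • θ) :=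
      (hv.continuous_fderiv one_ne_zero).comp hc
    have h2 : Continuous fun r : ℝ => v (x + r • θ) := hv.continuous.comp hc
    fun_prop
  have hFTC := intervalIntegral.integral_eq_sub_of_hasDerivAt (a := 0) (b := T)
    (fun r _ => hderiv r) (hcont.intervalIntegrable 0 T)
  rw [hgT, intervalIntegral.integral_of_le hT0] at hFTC
  calc ‖v x‖ₑ = ‖∫ r in Ioc 0 T, g' r‖ₑ := by rw [hFTC]; simp
    _ ≤ ∫⁻ r in Ioc 0 T, ‖g' r‖ₑ := enorm_integral_le_lintegral_enorm _
    _ = ∫⁻ r in Ioo 0 T, ‖g' r‖ₑ := by rw [restrict_congr_set Ioo_ae_eq_Ioc]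
    _ ≤ ∫⁻ r in Ioo 0 T,
        (ball (0 : E) R).indicator (fun y => ‖v y‖ₑ + ‖fderiv ℝ v y‖ₑ) (x + r • θ) := by
      refine setLIntegral_mono' measurableSet_Ioo fun r hr => ?_
      rw [indicator_of_mem (mem_ball_zero_iff.2 (hlt r ⟨hr.1.le, hr.2⟩)), add_comm]
      simp only [← ofReal_norm]
      rw [← ENNReal.ofReal_add (norm_nonneg _) (norm_nonneg _)]
      refine ENNReal.ofReal_le_ofReal ((norm_add_le _ _).trans ?_)
      rw [norm_smul, norm_smul, norm_neg, norm_one, one_mul]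
      gcongr
      have h1 : ‖1 - r‖ ≤ 1 := by
        rw [Real.norm_of_nonneg (by linarith [hr.2])]; linarith [hr.1]
      calc _ ≤ 1 * (‖fderiv ℝ v (x + r • θ)‖ * ‖θ‖) := by
            gcongr
            exact ContinuousLinearMap.le_opNorm _ _
        _ = _ := by rw [hθ]; ring
    _ ≤ _ := lintegral_mono_set (Ioo_subset_Ioo_right hT1)

end Radial

section Planar

variable {E F : Type*} [NormedAddCommGroup E] [NormedSpace ℝ E] [MeasurableSpace E] [BorelSpace E]
  [FiniteDimensional ℝ E]
  [NormedAddCommGroup F] [NormedSpace ℝ F] [CompleteSpace F]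

theorem toSphere_mul_enorm_le_lintegral (hE : finrank ℝ E = 2) (μ : Measure E)
    [μ.IsAddHaarMeasure] {v : E → F} (hv : ContDiff ℝ 1 v) {R : ℝ}
    (h0 : ∀ x ∈ sphere (0 : E) R, v x = 0) {x : E} (hx : x ∈ ball (0 : E) R) :
    μ.toSphere univ * ‖v x‖ₑ ≤ ∫⁻ z in ball (0 : E) 1, ENNReal.ofReal ‖z‖⁻¹ *
      (ball (0 : E) R).indicator (fun y => ‖v y‖ₑ + ‖fderiv ℝ v y‖ₑ) (x + z) ∂μ := by
  have : Nontrivial E := nontrivial_of_finrank_pos (R := ℝ) (by omega)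
  set G := (ball (0 : E) R).indicator (fun y => ‖v y‖ₑ + ‖fderiv ℝ v y‖ₑ) with hG
  have hGm : Measurable G := by
    refine Measurable.indicator ?_ measurableSet_ball
    exact (hv.continuous.enorm.add (hv.continuous_fderiv one_ne_zero).enorm).measurable
  have hm : Measurable fun z : E => ENNReal.ofReal ‖z‖⁻¹ * G (x + z) := by fun_prop
  rw [← lintegral_indicator measurableSet_ball,
    lintegral_eq_lintegral_toSphere μ (hm.indicator measurableSet_ball), mul_comm,
    ← lintegral_const]
  refine lintegral_mono fun θ => ?_
  have hθ : ‖(θ : E)‖ = 1 := norm_eq_of_mem_sphere θ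
  refine (enorm_le_lintegral_ray hv h0 hx hθ).trans ?_
  refine le_trans (le_of_eq ?_) (lintegral_mono_set (fun r (hr : r ∈ Ioo (0 : ℝ) 1) => hr.1))
  refine setLIntegral_congr_fun measurableSet_Ioo fun r hr => ?_
  have hn : ‖r • (θ : E)‖ = r := by rw [norm_smul, hθ, mul_one, Real.norm_of_nonneg hr.1.le]
  simp only [hE]
  have hmem : r • (θ : E) ∈ ball (0 : E) 1 := by rw [mem_ball_zero_iff, hn]; exact hr.2
  rw [indicator_of_mem hmem, hn, ← mul_assoc,
    ← ENNReal.ofReal_mul (pow_nonneg hr.1.le _)]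
  simp [hr.1.ne', hG]

theorem exists_lintegral_inv_norm_mul_le (hE : finrank ℝ E = 2) (μ : Measure E)
    [μ.IsAddHaarMeasure] {p : ℝ} (hp : 2 < p) :
    ∃ K : ℝ≥0∞, K ≠ ∞ ∧ ∀ f : E → ℝ≥0∞, Measurable f → ∀ x : E,
      ∫⁻ z in ball (0 : E) 1, ENNReal.ofReal ‖z‖⁻¹ * f (x + z) ∂μ ≤
        K * (∫⁻ y, f y ^ p ∂μ) ^ (1 / p) := by
  have : Nontrivial E := nontrivial_of_finrank_pos (R := ℝ) (by omega)
  have hpq : p.HolderConjugate (p / (p - 1)) := Real.HolderConjugate.conjExponent (by linarith)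
  set q := p / (p - 1) with hq
  have hq2 : q < 2 := by rw [hq, div_lt_iff₀ (by linarith)]; linarith
  have hq0 : 0 < q := hpq.symm.pos
  refine ⟨(∫⁻ z in ball (0 : E) 1, ENNReal.ofReal ‖z‖⁻¹ ^ q ∂μ) ^ (1 / q), ?_, ?_⟩
  · refine ENNReal.rpow_ne_top_of_nonneg (by positivity) ?_
    have hint : IntegrableOn (fun z : E => ‖z‖⁻¹ ^ q) (ball 0 1) μ := by
      rw [integrableOn_fun_norm_addHaar μ (f := fun r : ℝ => r⁻¹ ^ q)]
      have h1 : IntegrableOn (fun r : ℝ => r ^ (1 - q)) (Ioo 0 1) := by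
        rw [intervalIntegral.integrableOn_Ioo_rpow_iff one_pos]; linarith
      refine h1.congr_fun (fun r hr => ?_) measurableSet_Ioo
      simp only [hE, smul_eq_mul]
      rw [Real.inv_rpow hr.1.le, Real.rpow_sub hr.1, div_eq_mul_inv]
      simp
    have := hint.lintegral_lt_top
    simp_rw [ENNReal.ofReal_rpow_of_nonneg (inv_nonneg.2 (norm_nonneg _)) hq0.le]
    exact this.ne
  · intro f hf x
    refine (ENNReal.lintegral_mul_le_Lp_mul_Lq _ hpq.symm (by fun_prop) (by fun_prop)).trans ?_
    have := hpq.pos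
    refine mul_le_mul_right (ENNReal.rpow_le_rpow ?_ (by positivity)) _
    refine (setLIntegral_le_lintegral (μ := μ) _ _).trans (le_of_eq ?_)
    exact lintegral_add_left_eq_self (μ := μ) (fun y => f y ^ p) x

theorem exists_enorm_le_lintegral_rpow (hE : finrank ℝ E = 2) (μ : Measure E)
    [μ.IsAddHaarMeasure] {p q : ℝ} (hp : 2 < p) (hq : 2 < q) :
    ∃ K : ℝ≥0∞, K ≠ ∞ ∧ ∀ R : ℝ, ∀ v : E → F, ContDiff ℝ 1 v →
      (∀ x ∈ sphere (0 : E) R, v x = 0) → ∀ x ∈ ball (0 : E) R,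
      ‖v x‖ₑ ≤ K * ((∫⁻ y in ball (0 : E) R, ‖v y‖ₑ ^ p ∂μ) ^ (1 / p) +
        (∫⁻ y in ball (0 : E) R, ‖fderiv ℝ v y‖ₑ ^ q ∂μ) ^ (1 / q)) := by
  have : Nontrivial E := nontrivial_of_finrank_pos (R := ℝ) (by omega)
  obtain ⟨K₁, hK₁, h₁⟩ := exists_lintegral_inv_norm_mul_le hE μ hp
  obtain ⟨K₂, hK₂, h₂⟩ := exists_lintegral_inv_norm_mul_le hE μ hq
  have hσ0 : μ.toSphere univ ≠ 0 := by
    simpa only [ne_eq, measure_univ_eq_zero] using μ.toSphere_ne_zero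
  have hσt : μ.toSphere univ ≠ ∞ := measure_ne_top _ _
  refine ⟨(μ.toSphere univ)⁻¹ * (K₁ + K₂), by finiteness, fun R v hv h0 x hx => ?_⟩
  have hLp : ∀ (f : E → ℝ≥0∞) (s : ℝ), 2 < s →
      ∫⁻ y, (ball (0 : E) R).indicator f y ^ s ∂μ = ∫⁻ y in ball (0 : E) R, f y ^ s ∂μ := by
    intro f s hs
    rw [← lintegral_indicator measurableSet_ball]
    refine lintegral_congr fun y => ?_
    by_cases hy : y ∈ ball (0 : E) R
    · rw [indicator_of_mem hy, indicator_of_mem hy]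
    · rw [indicator_of_notMem hy, indicator_of_notMem hy, ENNReal.zero_rpow_of_pos (by linarith)]
  have hm₁ : Measurable ((ball (0 : E) R).indicator fun y => ‖v y‖ₑ) :=
    hv.continuous.enorm.measurable.indicator measurableSet_ball
  have hm₂ : Measurable ((ball (0 : E) R).indicator fun y => ‖fderiv ℝ v y‖ₑ) :=
    (hv.continuous_fderiv one_ne_zero).enorm.measurable.indicator measurableSet_ball
  have hb₁ := h₁ _ hm₁ x
  have hb₂ := h₂ _ hm₂ x
  rw [hLp _ _ hp] at hb₁
  rw [hLp _ _ hq] at hb₂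
  have hmain := toSphere_mul_enorm_le_lintegral hE μ hv h0 hx
  rw [mul_assoc, ← ENNReal.mul_le_iff_le_inv hσ0 hσt]
  refine hmain.trans ?_
  have hadd : ((ball (0 : E) R).indicator fun y => ‖v y‖ₑ + ‖fderiv ℝ v y‖ₑ) =
      (ball (0 : E) R).indicator (fun y => ‖v y‖ₑ) +
        (ball (0 : E) R).indicator (fun y => ‖fderiv ℝ v y‖ₑ) := indicator_add _ _ _
  rw [hadd]
  simp only [Pi.add_apply, mul_add]
  rw [lintegral_add_left (by fun_prop)]
  refine add_le_add (hb₁.trans ?_) (hb₂.trans ?_)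
  · gcongr; exact le_self_add
  · gcongr; exact le_add_self

end Planar

section Weight

theorem one_le_log_exp_one_add_sq (x : E13) : 1 ≤ Real.log (Real.exp 1 + ‖x‖ ^ 2) := by
  rw [Real.le_log_iff_exp_le (by positivity)]
  exact le_add_of_nonneg_right (by positivity)

theorem one_le_barx13 {η : ℝ} (hη : 0 < η) (x : E13) : 1 ≤ barx13 η x := by
  have h1 : 1 ≤ Real.sqrt (Real.exp 1 + ‖x‖ ^ 2) :=
    Real.one_le_sqrt.2 (by nlinarith [Real.add_one_le_exp 1, sq_nonneg ‖x‖])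
  exact one_le_mul_of_one_le_of_one_le h1
    (Real.one_le_rpow (one_le_log_exp_one_add_sq x) (by linarith))

theorem contDiff_barx13 (η : ℝ) : ContDiff ℝ 1 (barx13 η) := by
  have hs : ContDiff ℝ 1 fun x : E13 => Real.exp 1 + ‖x‖ ^ 2 :=
    contDiff_const.add (contDiff_norm_sq ℝ)
  have hs0 : ∀ x : E13, Real.exp 1 + ‖x‖ ^ 2 ≠ 0 := fun x => by positivity
  refine (hs.sqrt hs0).mul ((hs.log hs0).rpow_const_of_ne fun x => ?_)
  linarith [one_le_log_exp_one_add_sq x]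

theorem norm_gradient_eq (f : E13 → ℝ) (x : E13) : ‖gradient f x‖ = ‖fderiv ℝ f x‖ :=
  LinearIsometryEquiv.norm_map _ _

theorem norm_gradient_barx13_div_le {η : ℝ} (hη : 0 < η) (x : E13) :
    ‖gradient (barx13 η) x‖ / barx13 η x ≤
      (3 + 2 * η) * (‖x‖ / (Real.exp 1 + ‖x‖ ^ 2)) := by
  have hL := one_le_log_exp_one_add_sq x
  have hs : 0 < Real.exp 1 + ‖x‖ ^ 2 := by positivity
  set s := Real.exp 1 + ‖x‖ ^ 2
  have hL0 : 0 < Real.log s := by linarith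
  have hsq : 0 < Real.sqrt s := Real.sqrt_pos.2 hs
  have h1 : HasFDerivAt (fun y : E13 => Real.exp 1 + ‖y‖ ^ 2) (2 • innerSL ℝ x) x :=
    (hasStrictFDerivAt_norm_sq x).hasFDerivAt.const_add _
  have h2 := (Real.hasDerivAt_sqrt hs.ne').mul
    ((Real.hasDerivAt_log hs.ne').rpow_const (p := 1 + η) (Or.inl hL0.ne'))
  have h3 : HasFDerivAt (barx13 η) _ x :=
    HasDerivAt.comp_hasFDerivAt (h₂ := fun t => Real.sqrt t * Real.log t ^ (1 + η)) x h2 h1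
  have hpow : Real.log s ^ (1 + η - 1) = Real.log s ^ (1 + η) / Real.log s := by
    rw [Real.rpow_sub hL0, Real.rpow_one]
  have hP : 0 < Real.log s ^ (1 + η) := Real.rpow_pos_of_pos hL0 _
  have hb : barx13 η x = Real.sqrt s * Real.log s ^ (1 + η) := rfl
  have hn : ‖(2 • innerSL ℝ x : E13 →L[ℝ] ℝ)‖ = 2 * ‖x‖ := by
    rw [← Nat.cast_smul_eq_nsmul ℝ, norm_smul, innerSL_apply_norm]; simp
  rw [norm_gradient_eq, h3.fderiv, norm_smul, hn, hb, hpow, div_le_iff₀ (by positivity),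
    Real.norm_of_nonneg (by positivity)]
  have hss : Real.sqrt s * Real.sqrt s = s := Real.mul_self_sqrt hs.le
  have key : 1 / (2 * Real.sqrt s) * Real.log s ^ (1 + η) +
      Real.sqrt s * (s⁻¹ * (1 + η) * (Real.log s ^ (1 + η) / Real.log s)) =
      (1 / 2 + (1 + η) / Real.log s) * (Real.sqrt s * Real.log s ^ (1 + η) / s) := by
    have : s⁻¹ = (Real.sqrt s)⁻¹ * (Real.sqrt s)⁻¹ := by rw [← mul_inv, hss]
    rw [div_eq_mul_inv _ s, this]
    field_simp
  have hle : (1 + η) / Real.log s ≤ 1 + η := div_le_self (by linarith) hL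
  rw [key]
  calc _ ≤ (1 / 2 + (1 + η)) * (Real.sqrt s * Real.log s ^ (1 + η) / s) * (2 * ‖x‖) := by gcongr
    _ = _ := by ring

theorem continuous_norm_gradient_barx13_div {η : ℝ} (hη : 0 < η) :
    Continuous fun y : E13 => ‖gradient (barx13 η) y‖ / barx13 η y := by
  simp_rw [norm_gradient_eq]
  refine ((contDiff_barx13 η).continuous_fderiv one_ne_zero).norm.div
    (contDiff_barx13 η).continuous fun x => ?_
  linarith [one_le_barx13 hη x]

theorem integrable_norm_gradient_barx13_div_rpow {η : ℝ} (hη : 0 < η) {s : ℝ} (hs : 2 < s) :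
    Integrable (fun y : E13 => (‖gradient (barx13 η) y‖ / barx13 η y) ^ s) volume := by
  have hdom : Integrable (fun y : E13 => (2 * (3 + 2 * η)) ^ s * (1 + ‖y‖) ^ (-s)) volume :=
    (integrable_one_add_norm (by simpa using hs)).const_mul _
  refine hdom.mono' ?_ (Filter.Eventually.of_forall fun y => ?_)
  · exact ((continuous_norm_gradient_barx13_div hη).rpow_const
      fun _ => Or.inr (by linarith)).aestronglyMeasurable
  · have hb : 0 ≤ ‖gradient (barx13 η) y‖ / barx13 η y :=
      div_nonneg (norm_nonneg _) (by linarith [one_le_barx13 hη y])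
    rw [Real.norm_of_nonneg (Real.rpow_nonneg hb _), Real.rpow_neg (by positivity),
      ← div_eq_mul_inv, ← Real.div_rpow (by positivity) (by positivity)]
    refine Real.rpow_le_rpow hb ?_ (by linarith)
    refine (norm_gradient_barx13_div_le hη y).trans ?_
    rw [show 2 * (3 + 2 * η) / (1 + ‖y‖) = (3 + 2 * η) * (2 / (1 + ‖y‖)) by ring]
    refine mul_le_mul_of_nonneg_left ?_ (by positivity)
    rw [div_le_div_iff₀ (by positivity) (by positivity)]
    nlinarith [Real.exp_pos 1, Real.add_one_le_exp 1, sq_nonneg (‖y‖ - 1), norm_nonneg y]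

end Weight

section Velocity

theorem norm_fderiv_le_sqrt_sum_sq {u : E13 → E13} (hu : ContDiff ℝ 1 u) (y : E13) :
    ‖fderiv ℝ u y‖ ≤ Real.sqrt (∑ i, ∑ j, (fderiv ℝ (fun z => u z j) y
      (EuclideanSpace.single i 1)) ^ 2) := by
  have hj : ∀ j θ, fderiv ℝ (fun z => u z j) y θ = fderiv ℝ u y θ j := by
    intro j θ
    have h := (EuclideanSpace.proj (𝕜 := ℝ) j : E13 →L[ℝ] ℝ).hasFDerivAt.comp y
      (hu.differentiable one_ne_zero y).hasFDerivAt
    have h' : HasFDerivAt (fun z => u z j) _ y := h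
    rw [h'.fderiv]
    rfl
  refine ContinuousLinearMap.opNorm_le_bound _ (Real.sqrt_nonneg _) fun θ => ?_
  simp_rw [hj]
  have hθ : θ = θ 0 • EuclideanSpace.single 0 1 + θ 1 • EuclideanSpace.single 1 1 := by
    ext i; fin_cases i <;> simp
  rw [EuclideanSpace.norm_eq, EuclideanSpace.norm_eq, ← Real.sqrt_mul (by positivity)]
  refine Real.sqrt_le_sqrt ?_
  conv_lhs => rw [hθ]
  simp only [Real.norm_eq_abs, sq_abs, Fin.sum_univ_two, map_add, map_smul, PiLp.add_apply,
    PiLp.smul_apply, smul_eq_mul]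
  generalize fderiv ℝ u y (EuclideanSpace.single 0 1) = a
  generalize fderiv ℝ u y (EuclideanSpace.single 1 1) = b
  nlinarith [sq_nonneg (θ 0 * b 0 - θ 1 * a 0), sq_nonneg (θ 0 * b 1 - θ 1 * a 1)]

theorem continuous_sqrt_sum_sq_fderiv {u : E13 → E13} (hu : ContDiff ℝ 1 u) :
    Continuous fun y => Real.sqrt (∑ i, ∑ j, (fderiv ℝ (fun z => u z j) y
      (EuclideanSpace.single i 1)) ^ 2) := by
  have h : ∀ j, Continuous (fderiv ℝ fun z => u z j) := fun j =>
    ((contDiff_euclidean.1 hu) j).continuous_fderiv one_ne_zero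
  fun_prop

theorem contDiff_barx13_rpow {η : ℝ} (hη : 0 < η) (δ : ℝ) :
    ContDiff ℝ 1 fun y => barx13 η y ^ (-δ) :=
  (contDiff_barx13 η).rpow_const_of_ne fun x => by linarith [one_le_barx13 hη x]

theorem norm_fderiv_barx13_rpow_smul_le {η δ : ℝ} (hη : 0 < η) (hδ0 : 0 ≤ δ) (hδ1 : δ ≤ 1)
    {u : E13 → E13} (hu : ContDiff ℝ 1 u) (y : E13) :
    ‖fderiv ℝ (fun z => barx13 η z ^ (-δ) • u z) y‖ ≤ ‖fderiv ℝ u y‖ +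
      ‖u y‖ * barx13 η y ^ (-δ) * (‖gradient (barx13 η) y‖ / barx13 η y) := by
  have hb1 := one_le_barx13 hη y
  have hb : 0 < barx13 η y := by linarith
  have h1 := ((contDiff_barx13 η).differentiable one_ne_zero y).hasFDerivAt.rpow_const
    (p := -δ) (Or.inl hb.ne')
  have h2 : HasFDerivAt (fun z => barx13 η z ^ (-δ) • u z) _ y :=
    h1.smul (hu.differentiable one_ne_zero y).hasFDerivAt
  rw [h2.fderiv, norm_gradient_eq]
  refine (norm_add_le _ _).trans (add_le_add ?_ ?_)
  · rw [norm_smul, Real.norm_of_nonneg (Real.rpow_nonneg hb.le _)]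
    exact mul_le_of_le_one_left (norm_nonneg _)
      (Real.rpow_le_one_of_one_le_of_nonpos hb1 (by linarith))
  · rw [ContinuousLinearMap.norm_smulRight_apply, norm_smul, norm_mul, norm_neg,
      Real.norm_of_nonneg hδ0, Real.norm_of_nonneg (Real.rpow_nonneg hb.le _),
      Real.rpow_sub hb, Real.rpow_one]
    have : 0 ≤ barx13 η y ^ (-δ) := Real.rpow_nonneg hb.le _
    calc _ ≤ 1 * (barx13 η y ^ (-δ) / barx13 η y) * ‖fderiv ℝ (barx13 η) y‖ * ‖u y‖ := by gcongr
      _ = _ := by ring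

end Velocity

section Norms

theorem lintegral_ofReal_rpow_eq {f : E13 → ℝ} (hf : Continuous f) (hf0 : ∀ y, 0 ≤ f y)
    {p : ℝ} (hp : 0 < p) (r R : ℝ) (hr : 0 ≤ r) :
    (∫⁻ y in ball (0 : E13) R, ENNReal.ofReal (f y) ^ p) ^ r =
      ENNReal.ofReal ((∫ y in ball (0 : E13) R, f y ^ p) ^ r) := by
  have hc : Continuous fun y => f y ^ p := hf.rpow_const fun _ => Or.inr hp.le
  have hint : IntegrableOn (fun y => f y ^ p) (ball (0 : E13) R) :=
    (hc.continuousOn.integrableOn_compact (isCompact_closedBall 0 R)).mono_set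
      ball_subset_closedBall
  simp_rw [ENNReal.ofReal_rpow_of_nonneg (hf0 _) hp.le]
  rw [← ofReal_integral_eq_lintegral_ofReal hint
    (Filter.Eventually.of_forall fun y => Real.rpow_nonneg (hf0 y) p),
    ENNReal.ofReal_rpow_of_nonneg (integral_nonneg fun y => Real.rpow_nonneg (hf0 y) p) hr]

theorem lintegral_add_mul_rpow_le {α : Type*} [MeasurableSpace α] (μ : Measure α)
    {f g h : α → ℝ≥0∞} (hf : Measurable f) (hg : Measurable g) (hh : Measurable h)
    {p q r : ℝ} (hp : 1 ≤ p) (hpq : p < q) (hpqr : 1 / p = 1 / q + 1 / r) :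
    (∫⁻ a, (f a + g a * h a) ^ p ∂μ) ^ (1 / p) ≤ (∫⁻ a, f a ^ p ∂μ) ^ (1 / p) +
      (∫⁻ a, g a ^ q ∂μ) ^ (1 / q) * (∫⁻ a, h a ^ r ∂μ) ^ (1 / r) := by
  refine (ENNReal.lintegral_Lp_add_le hf.aemeasurable (hg.mul hh).aemeasurable hp).trans ?_
  gcongr
  exact ENNReal.lintegral_Lp_mul_le_Lq_mul_Lr (by linarith) hpq hpqr μ hg.aemeasurable
    hh.aemeasurable

end Norms

end WeightedEstimate

/-- Estimate (3.35): L^∞ bound for the velocity weighted by `x̄^{-δ}`, via the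
Sobolev embedding applied to `u x̄^{-δ}`, together with the finiteness of
`‖x̄⁻¹ ∇x̄‖_{L^{12/(4-3δ)}(ℝ²)}`. -/
theorem stmt13 (η₀ δ : ℝ) (hη : 0 < η₀) (hδ0 : 0 < δ) (hδ1 : δ < 1) :
    ∃ C > 0,
      (∀ R : ℝ, 1 ≤ R → ∀ u : E13 → E13,
        (∀ j : Fin 2, ContDiff ℝ (⊤ : ℕ∞) (fun x => u x j)) →
        (∀ x ∈ sphere (0 : E13) R, u x = 0) →
        ∀ x ∈ ball (0 : E13) R,
          ‖u x‖ * barx13 η₀ x ^ (-δ)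
            ≤ C * ((∫ y in ball (0 : E13) R,
                  (‖u y‖ * barx13 η₀ y ^ (-δ)) ^ (4 / δ)) ^ (δ / 4)
              + (∫ y in ball (0 : E13) R,
                  (Real.sqrt (∑ i, ∑ j, (fderiv ℝ (fun z => u z j) y
                    (EuclideanSpace.single i 1)) ^ 2)) ^ (3 : ℝ)) ^ ((1 : ℝ) / 3)
              + (∫ y in ball (0 : E13) R,
                  (‖u y‖ * barx13 η₀ y ^ (-δ)) ^ (4 / δ)) ^ (δ / 4)
                * (∫ y in ball (0 : E13) R,
                    (‖gradient (barx13 η₀) y‖ / barx13 η₀ y)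
                      ^ (12 / (4 - 3 * δ))) ^ ((4 - 3 * δ) / 12)))
      ∧ Integrable (fun y : E13 =>
          (‖gradient (barx13 η₀) y‖ / barx13 η₀ y) ^ (12 / (4 - 3 * δ))) volume := by
  obtain ⟨K, hK, hmain⟩ := exists_enorm_le_lintegral_rpow (F := E13) (E := E13) (by simp) volume
    (p := 4 / δ) (q := 3) (by rw [lt_div_iff₀ hδ0]; linarith) (by norm_num)
  refine ⟨K.toReal + 1, by positivity, ?_, ?_⟩
  · intro R _ u hu h0 x hx
    have hu1 : ContDiff ℝ 1 u := contDiff_euclidean.2 fun j => (hu j).of_le (by norm_num)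
    have hw0 : ∀ y, 0 ≤ barx13 η₀ y ^ (-δ) := fun y =>
      Real.rpow_nonneg (by linarith [one_le_barx13 hη y]) _
    have hV0 : ∀ y, 0 ≤ ‖u y‖ * barx13 η₀ y ^ (-δ) := fun y => mul_nonneg (norm_nonneg _) (hw0 y)
    have hH0 : ∀ y, 0 ≤ ‖gradient (barx13 η₀) y‖ / barx13 η₀ y := fun y =>
      div_nonneg (norm_nonneg _) (by linarith [one_le_barx13 hη y])
    have hVc : Continuous fun y => ‖u y‖ * barx13 η₀ y ^ (-δ) :=
      hu1.continuous.norm.mul (contDiff_barx13_rpow hη δ).continuous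
    have hHc := continuous_norm_gradient_barx13_div hη
    have hGc := continuous_sqrt_sum_sq_fderiv hu1
    have hv : ContDiff ℝ 1 fun y => barx13 η₀ y ^ (-δ) • u y := (contDiff_barx13_rpow hη δ).smul hu1
    have hvn : ∀ y, ‖barx13 η₀ y ^ (-δ) • u y‖ₑ =
        ENNReal.ofReal (‖u y‖ * barx13 η₀ y ^ (-δ)) := by
      intro y
      rw [← ofReal_norm, norm_smul, Real.norm_of_nonneg (hw0 y), mul_comm]
    have hbound := hmain R _ hv (fun y hy => by rw [h0 y hy, smul_zero]) x hx
    simp_rw [hvn] at hbound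
    have hpt : ∀ y, ‖fderiv ℝ (fun z => barx13 η₀ z ^ (-δ) • u z) y‖ₑ ≤
        ENNReal.ofReal (Real.sqrt (∑ i, ∑ j, (fderiv ℝ (fun z => u z j) y
          (EuclideanSpace.single i 1)) ^ 2)) + ENNReal.ofReal (‖u y‖ * barx13 η₀ y ^ (-δ)) *
            ENNReal.ofReal (‖gradient (barx13 η₀) y‖ / barx13 η₀ y) := by
      intro y
      rw [← ENNReal.ofReal_mul (hV0 y), ← ENNReal.ofReal_add (Real.sqrt_nonneg _)
        (mul_nonneg (hV0 y) (hH0 y)), ← ofReal_norm]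
      refine ENNReal.ofReal_le_ofReal
        ((norm_fderiv_barx13_rpow_smul_le hη hδ0.le hδ1.le hu1 y).trans ?_)
      gcongr
      exact norm_fderiv_le_sqrt_sum_sq hu1 y
    have hgrad := (ENNReal.rpow_le_rpow (lintegral_mono fun y =>
        ENNReal.rpow_le_rpow (hpt y) (by norm_num : (0 : ℝ) ≤ 3))
        (by norm_num : (0 : ℝ) ≤ 1 / 3)).trans
      (lintegral_add_mul_rpow_le (p := 3) (q := 4 / δ) (r := 12 / (4 - 3 * δ))
        (volume.restrict (ball (0 : E13) R)) hGc.measurable.ennreal_ofReal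
        hVc.measurable.ennreal_ofReal hHc.measurable.ennreal_ofReal (by norm_num)
        (by rw [lt_div_iff₀ hδ0]; linarith) (by rw [one_div_div, one_div_div]; ring))
    have hs : 0 < 12 / (4 - 3 * δ) := div_pos (by norm_num) (by linarith)
    rw [one_div_div] at hbound
    rw [one_div_div, one_div_div,
      lintegral_ofReal_rpow_eq hGc (fun _ => Real.sqrt_nonneg _) three_pos _ _ (by positivity),
      lintegral_ofReal_rpow_eq hVc hV0 (by positivity) _ _ (by positivity),
      lintegral_ofReal_rpow_eq hHc hH0 hs _ _ (by linarith),
      ← ENNReal.ofReal_mul (Real.rpow_nonneg (integral_nonneg fun y =>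
        Real.rpow_nonneg (hV0 y) _) _)] at hgrad
    rw [lintegral_ofReal_rpow_eq hVc hV0 (by positivity) _ _ (by positivity)] at hbound
    have hX := Real.rpow_nonneg (integral_nonneg (μ := volume.restrict (ball (0 : E13) R))
      fun y => Real.rpow_nonneg (hV0 y) (4 / δ)) (δ / 4)
    have hY := Real.rpow_nonneg (integral_nonneg (μ := volume.restrict (ball (0 : E13) R))
      fun y => Real.rpow_nonneg (Real.sqrt_nonneg (∑ i, ∑ j, (fderiv ℝ (fun z => u z j) y
        (EuclideanSpace.single i 1)) ^ 2)) (3 : ℝ)) ((1 : ℝ) / 3)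
    have hZ := Real.rpow_nonneg (integral_nonneg (μ := volume.restrict (ball (0 : E13) R))
      fun y => Real.rpow_nonneg (hH0 y) (12 / (4 - 3 * δ))) ((4 - 3 * δ) / 12)
    have hXZ := mul_nonneg hX hZ
    replace hbound := hbound.trans (mul_le_mul_right (add_le_add_right hgrad _) K)
    rw [← ENNReal.ofReal_add hY hXZ, ← ENNReal.ofReal_add hX (add_nonneg hY hXZ),
      ← ENNReal.ofReal_toReal hK, ← ENNReal.ofReal_mul ENNReal.toReal_nonneg,
      ENNReal.ofReal_le_ofReal_iff (mul_nonneg ENNReal.toReal_nonneg (by positivity)),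
      ← add_assoc] at hbound
    refine hbound.trans (mul_le_mul_of_nonneg_right (by linarith) (by positivity))
  · refine integrable_norm_gradient_barx13_div_rpow hη ?_
    rw [lt_div_iff₀ (by linarith)]
    linarith

end
end
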